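/- arXiv:math/0108126 — 5 statements merged into one kernel-verified Lean document; each statement's English description precedes it below -/
import Mathlib

section
/- The multiplication on the crossed product algebra A ⋊ H, defined by (a ⊗ g)(b ⊗ h) = a b^{(0̄)} ⊗ S^{-1}(b^{(1̄)}) g b^{(2̄)} h, is associative: for all a, b, c ∈ A and g, h, k ∈ H, ((a ⊗ g)(b ⊗ h))(c ⊗ k) = (a ⊗ g)((b ⊗ h)(c ⊗ k)). -/
open TensorProduct Coalgebra

noncomputable section

variable {k : Type} [CommRing k]
variable {H : Type} [Ring H] [HopfAlgebra k H]
variable {A : Type} [Ring A] [Algebra k A]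

/-- The multiplication of the crossed product algebra `A ⋊ H` of a left `H`-comodule
algebra `A`, as a linear map on `(A ⊗ H) ⊗ (A ⊗ H)`.  On pure tensors it is given by
`(a ⊗ g) ⊗ (b ⊗ h) ↦ a b⁽⁰⁾ ⊗ S⁻¹(b⁽¹⁾) g b⁽²⁾ h`, where
`b⁽²⁾ ⊗ b⁽¹⁾ ⊗ b⁽⁰⁾ = ((Δ ⊗ id) ∘ α)(b)` (Sweedler notation). -/
def cpMul (Sinv : H →ₗ[k] H) (ρ : A →ₗ[k] H ⊗[k] A) :
    ((A ⊗[k] H) ⊗[k] (A ⊗[k] H)) →ₗ[k] (A ⊗[k] H) :=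
  (TensorProduct.map (LinearMap.mul' k A)
      (LinearMap.mul' k H
        ∘ₗ TensorProduct.map Sinv
            (LinearMap.mul' k H ∘ₗ LinearMap.lTensor H (LinearMap.mul' k H))
        ∘ₗ (TensorProduct.leftComm k H H (H ⊗[k] H)).toLinearMap))
    ∘ₗ (TensorProduct.tensorTensorTensorComm k A H A (H ⊗[k] (H ⊗[k] H))).toLinearMap
    ∘ₗ (LinearMap.lTensor (A ⊗[k] H)
          ((LinearMap.lTensor A (TensorProduct.assoc k H H H).toLinearMap)
            ∘ₗ (TensorProduct.assoc k A (H ⊗[k] H) H).toLinearMap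
            ∘ₗ (LinearMap.rTensor H (LinearMap.lTensor A (TensorProduct.comm k H H).toLinearMap))
            ∘ₗ (LinearMap.rTensor H (TensorProduct.comm k (H ⊗[k] H) A).toLinearMap)
            ∘ₗ (LinearMap.rTensor H
                  ((LinearMap.rTensor A (Coalgebra.comul (R := k))) ∘ₗ ρ))))

section AntipodeInverse

variable {Sinv : H →ₗ[k] H}

lemma antipodeInv_mul (hSinv₁ : ∀ h : H, Sinv (HopfAlgebra.antipode (R := k) h) = h)
    (hSinv₂ : ∀ h : H, HopfAlgebra.antipode (R := k) (Sinv h) = h) (x y : H) :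
    Sinv (x * y) = Sinv y * Sinv x := by
  rw [← hSinv₁ (Sinv y * Sinv x), HopfAlgebra.antipode_mul_antidistrib, hSinv₂, hSinv₂]

/-- `x⁽²⁾ S⁻¹(x⁽¹⁾) = ε(x)`. -/
lemma sum_right_mul_antipodeInv_left
    (hSinv₁ : ∀ h : H, Sinv (HopfAlgebra.antipode (R := k) h) = h)
    (hSinv₂ : ∀ h : H, HopfAlgebra.antipode (R := k) (Sinv h) = h)
    {ι : Type*} {x : H} (r : Repr k x ι) :
    ∑ i ∈ r.index, r.right i * Sinv (r.left i) = counit (R := k) x • (1 : H) := by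
  have hone : Sinv 1 = 1 := by
    simpa [HopfAlgebra.antipode_one] using hSinv₁ 1
  conv_rhs => rw [← hone]
  rw [← map_smul, ← HopfAlgebra.sum_mul_antipode_eq_smul r, map_sum]
  refine Finset.sum_congr rfl fun i _ => ?_
  rw [antipodeInv_mul hSinv₁ hSinv₂, hSinv₁]

end AntipodeInverse

/-- The map `p ⊗ q ↦ S⁻¹(q) g p`. -/
def antipodeInvSandwich (Sinv : H →ₗ[k] H) (g : H) : H ⊗[k] H →ₗ[k] H :=
  LinearMap.mul' k H ∘ₗ TensorProduct.map (LinearMap.mulRight k g ∘ₗ Sinv) LinearMap.id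
    ∘ₗ (TensorProduct.comm k H H).toLinearMap

@[simp]
lemma antipodeInvSandwich_tmul (Sinv : H →ₗ[k] H) (g p q : H) :
    antipodeInvSandwich Sinv g (p ⊗ₜ[k] q) = Sinv q * g * p := by
  simp [antipodeInvSandwich]

/-- The right action `x ↦ S⁻¹(x⁽²⁾) g x⁽¹⁾` of `H` on an element `g` of itself. -/
def antipodeInvConj (Sinv : H →ₗ[k] H) (g : H) : H →ₗ[k] H :=
  antipodeInvSandwich Sinv g ∘ₗ comul

lemma antipodeInvConj_eq_sum (Sinv : H →ₗ[k] H) (g : H) {ι : Type*} {x : H} (r : Repr k x ι) :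
    antipodeInvConj Sinv g x = ∑ i ∈ r.index, Sinv (r.right i) * g * r.left i := by
  simp [antipodeInvConj, ← r.eq]

section Conj

variable {Sinv : H →ₗ[k] H}

lemma antipodeInvConj_mul_right
    (hSinv₁ : ∀ h : H, Sinv (HopfAlgebra.antipode (R := k) h) = h)
    (hSinv₂ : ∀ h : H, HopfAlgebra.antipode (R := k) (Sinv h) = h)
    (g x y : H) :
    antipodeInvConj Sinv g (x * y) = antipodeInvConj Sinv (antipodeInvConj Sinv g x) y := by
  rw [antipodeInvConj_eq_sum Sinv _ (ℛ k y), antipodeInvConj_eq_sum Sinv _ (ℛ k x)]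
  simp only [antipodeInvConj, LinearMap.comp_apply, Bialgebra.comul_mul]
  rw [← (ℛ k x).eq, ← (ℛ k y).eq]
  simp only [Finset.sum_mul, Finset.mul_sum, map_sum, Algebra.TensorProduct.tmul_mul_tmul,
    antipodeInvSandwich_tmul, antipodeInv_mul hSinv₁ hSinv₂, mul_assoc]

lemma sum_antipodeInvConj_mul_antipodeInv
    (hSinv₁ : ∀ h : H, Sinv (HopfAlgebra.antipode (R := k) h) = h)
    (hSinv₂ : ∀ h : H, HopfAlgebra.antipode (R := k) (Sinv h) = h)
    (g : H) {ι : Type*} {x : H} (r : Repr k x ι) :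
    ∑ i ∈ r.index, antipodeInvConj Sinv g (r.right i) * Sinv (r.left i) = Sinv x * g := by
  have h := congrArg (LinearMap.mul' k H ∘ₗ
    TensorProduct.map (antipodeInvSandwich Sinv g) Sinv ∘ₗ
    (TensorProduct.comm k H (H ⊗[k] H)).toLinearMap)
    (sum_tmul_tmul_eq r (fun i => ℛ k (r.left i)) (fun i => ℛ k (r.right i)))
  simp only [map_sum, LinearMap.comp_apply, LinearEquiv.coe_coe, TensorProduct.comm_tmul,
    TensorProduct.map_tmul, LinearMap.mul'_apply, antipodeInvSandwich_tmul] at h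
  simp only [fun i => antipodeInvConj_eq_sum Sinv g (ℛ k (r.right i)), Finset.sum_mul]
  rw [← h]
  simp only [mul_assoc, ← Finset.mul_sum, sum_right_mul_antipodeInv_left hSinv₁ hSinv₂]
  conv_rhs => rw [← sum_counit_smul r]
  simp [Finset.sum_mul]

lemma sum_antipodeInvConj_mul_antipodeInvConj
    (hSinv₁ : ∀ h : H, Sinv (HopfAlgebra.antipode (R := k) h) = h)
    (hSinv₂ : ∀ h : H, HopfAlgebra.antipode (R := k) (Sinv h) = h)
    (g h : H) {ι : Type*} {x : H} (r : Repr k x ι) :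
    ∑ i ∈ r.index, antipodeInvConj Sinv g (r.right i) * antipodeInvConj Sinv h (r.left i)
      = antipodeInvConj Sinv (g * h) x := by
  have h_assoc := congrArg (LinearMap.mul' k H ∘ₗ
    TensorProduct.map (LinearMap.mul' k H ∘ₗ
        TensorProduct.map (antipodeInvConj Sinv g) (LinearMap.mulRight k h ∘ₗ Sinv) ∘ₗ
        (TensorProduct.comm k H H).toLinearMap) LinearMap.id ∘ₗ
    (TensorProduct.comm k H (H ⊗[k] H)).toLinearMap)
    (sum_tmul_tmul_eq r (fun i => ℛ k (r.left i)) (fun i => ℛ k (r.right i)))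
  simp only [map_sum, LinearMap.comp_apply, LinearEquiv.coe_coe, TensorProduct.comm_tmul,
    TensorProduct.map_tmul, LinearMap.mul'_apply, LinearMap.mulRight_apply,
    LinearMap.id_apply, ← mul_assoc] at h_assoc
  simp only [fun i => antipodeInvConj_eq_sum Sinv h (ℛ k (r.left i)), Finset.mul_sum,
    ← mul_assoc]
  rw [h_assoc, antipodeInvConj_eq_sum Sinv _ r]
  simp only [← Finset.sum_mul, sum_antipodeInvConj_mul_antipodeInv hSinv₁ hSinv₂]
  simp only [mul_assoc]

end Conj

/-- The map `x ⊗ b ↦ a b ⊗ S⁻¹(x⁽²⁾) g x⁽¹⁾`. -/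
def cpTwist (Sinv : H →ₗ[k] H) (a : A) (g : H) : H ⊗[k] A →ₗ[k] A ⊗[k] H :=
  (TensorProduct.comm k H A).toLinearMap ∘ₗ
    TensorProduct.map (antipodeInvConj Sinv g) (LinearMap.mulLeft k a)

@[simp]
lemma cpTwist_tmul (Sinv : H →ₗ[k] H) (a b : A) (g x : H) :
    cpTwist Sinv a g (x ⊗ₜ[k] b) = (a * b) ⊗ₜ[k] antipodeInvConj Sinv g x := by
  simp [cpTwist]

lemma cpMul_tmul_tmul (Sinv : H →ₗ[k] H) (ρ : A →ₗ[k] H ⊗[k] A) (a b : A) (g h : H) :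
    cpMul Sinv ρ ((a ⊗ₜ[k] g) ⊗ₜ[k] (b ⊗ₜ[k] h))
      = cpTwist Sinv a g (ρ b) * ((1 : A) ⊗ₜ[k] h) := by
  simp only [cpMul, LinearMap.comp_apply, LinearMap.lTensor_tmul, LinearMap.rTensor_tmul,
    LinearEquiv.coe_coe]
  induction ρ b with
  | zero => simp
  | add s t hs ht =>
    simp only [map_add, add_mul, TensorProduct.add_tmul, TensorProduct.tmul_add, hs, ht]
  | tmul x b₀ =>
    rw [cpTwist_tmul, antipodeInvConj_eq_sum Sinv g (ℛ k x), LinearMap.rTensor_tmul,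
      ← (ℛ k x).eq]
    simp [TensorProduct.sum_tmul, TensorProduct.tmul_sum, Finset.sum_mul, mul_assoc]

/-- The multiplication of the crossed product algebra `A ⋊ H`,
`(a ⊗ g)(b ⊗ h) = a b⁽⁰⁾ ⊗ S⁻¹(b⁽¹⁾) g b⁽²⁾ h`, is associative. -/
theorem cpMul_assoc
    (Sinv : H →ₗ[k] H)
    (hSinv₁ : ∀ h : H, Sinv (HopfAlgebra.antipode (R := k) h) = h)
    (hSinv₂ : ∀ h : H, HopfAlgebra.antipode (R := k) (Sinv h) = h)
    (α : A →ₐ[k] H ⊗[k] A)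
    (hcoassoc : ∀ a : A,
      (TensorProduct.assoc k H H A) ((LinearMap.rTensor A (Coalgebra.comul (R := k))) (α a))
        = (LinearMap.lTensor H α.toLinearMap) (α a))
    (hcounit : ∀ a : A,
      (TensorProduct.lid k A) ((LinearMap.rTensor A (Coalgebra.counit (R := k))) (α a)) = a)
    (a b c : A) (g h l : H) :
    cpMul Sinv α.toLinearMap
        ((cpMul Sinv α.toLinearMap ((a ⊗ₜ[k] g) ⊗ₜ[k] (b ⊗ₜ[k] h))) ⊗ₜ[k] (c ⊗ₜ[k] l))
      = cpMul Sinv α.toLinearMap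
          ((a ⊗ₜ[k] g) ⊗ₜ[k] (cpMul Sinv α.toLinearMap ((b ⊗ₜ[k] h) ⊗ₜ[k] (c ⊗ₜ[k] l)))) := by
  let R (B : H ⊗[k] A) : H ⊗[k] (H ⊗[k] A) →ₗ[k] A ⊗[k] H :=
    LinearMap.mul' k (A ⊗[k] H) ∘ₗ (TensorProduct.comm k _ _).toLinearMap ∘ₗ
      TensorProduct.map
        (TensorProduct.mk k A H 1 ∘ₗ LinearMap.mulRight k l ∘ₗ antipodeInvConj Sinv h)
        (cpTwist Sinv a g ∘ₗ LinearMap.mulLeft k B)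
  have hR (B : H ⊗[k] A) (x : H) (w : H ⊗[k] A) :
      R B (x ⊗ₜ[k] w)
        = cpTwist Sinv a g (B * w) * ((1 : A) ⊗ₜ[k] (antipodeInvConj Sinv h x * l)) := by
    simp [R]
  have hRadd (B C : H ⊗[k] A) (t) : R (B + C) t = R B t + R C t := by
    induction t with
    | zero => simp
    | add s t hs ht => simp only [map_add, hs, ht]; abel
    | tmul x w => simp only [hR, add_mul, map_add]
  have right_eq : cpMul Sinv α.toLinearMap ((a ⊗ₜ[k] g) ⊗ₜ[k]
      (cpMul Sinv α.toLinearMap ((b ⊗ₜ[k] h) ⊗ₜ[k] (c ⊗ₜ[k] l))))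
      = R (α b) (LinearMap.lTensor H α.toLinearMap (α c)) := by
    rw [cpMul_tmul_tmul, AlgHom.toLinearMap_apply]
    induction α c with
    | zero => simp
    | add s t hs ht => simp only [map_add, add_mul, TensorProduct.tmul_add, hs, ht]
    | tmul x c₀ =>
      rw [cpTwist_tmul, Algebra.TensorProduct.tmul_mul_tmul, mul_one, cpMul_tmul_tmul,
        LinearMap.lTensor_tmul, hR]
      simp
  rw [right_eq, ← hcoassoc, cpMul_tmul_tmul, AlgHom.toLinearMap_apply]
  induction α b with
  | zero => simp [R]
  | add s t hs ht => simp only [map_add, add_mul, TensorProduct.add_tmul, hRadd, hs, ht]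
  | tmul y b₀ =>
    rw [cpTwist_tmul, Algebra.TensorProduct.tmul_mul_tmul, mul_one, cpMul_tmul_tmul,
      AlgHom.toLinearMap_apply]
    induction α c with
    | zero => simp
    | add s t hs ht => simp only [map_add, add_mul, hs, ht]
    | tmul x c₀ =>
      rw [cpTwist_tmul, LinearMap.rTensor_tmul, ← (ℛ k x).eq,
        ← sum_antipodeInvConj_mul_antipodeInvConj hSinv₁ hSinv₂ _ _ (ℛ k x)]
      simp [TensorProduct.sum_tmul, TensorProduct.tmul_sum, Finset.sum_mul, hR, mul_assoc,
        antipodeInvConj_mul_right hSinv₁ hSinv₂]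

end
end

section
/- The map ε_C ⊗ ε_H is a counit for the crossed product coalgebra C >◀ H: ((ε_C ⊗ ε_H) ⊗ id)∘Δ = id = (id ⊗ (ε_C ⊗ ε_H))∘Δ on C ⊗ H. -/
open TensorProduct Coalgebra

noncomputable section

variable {k : Type} [CommRing k]
variable {H : Type} [Ring H] [HopfAlgebra k H]
variable {C : Type} [AddCommGroup C] [Module k C] [Coalgebra k C]

/-- The comultiplication of the crossed product coalgebra `C >◀ H` of a left
`H`-module coalgebra `C`, as a linear map `C ⊗ H →ₗ (C ⊗ H) ⊗ (C ⊗ H)`.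
On pure tensors it is given (in Sweedler notation) by
`Δ(a ⊗ g) = (a⁽⁰⁾ ⊗ g⁽¹⁾) ⊗ (S⁻¹(g⁽⁰⁾ S(g⁽²⁾)) · a⁽¹⁾ ⊗ g⁽³⁾)`. -/
def cpComul (Sinv : H →ₗ[k] H) (act : H →ₗ[k] C →ₗ[k] C) :
    (C ⊗[k] H) →ₗ[k] ((C ⊗[k] H) ⊗[k] (C ⊗[k] H)) :=
  (LinearMap.lTensor (C ⊗[k] H)
      ((LinearMap.rTensor H (TensorProduct.lift act))
        ∘ₗ (TensorProduct.assoc k H C H).symm.toLinearMap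
        ∘ₗ (TensorProduct.leftComm k C H H).toLinearMap))
    ∘ₗ (TensorProduct.tensorTensorTensorComm k C C H (H ⊗[k] H)).toLinearMap
    ∘ₗ (TensorProduct.map (Coalgebra.comul (R := k))
          ((LinearMap.lTensor H
              ((LinearMap.rTensor H Sinv)
                ∘ₗ (LinearMap.rTensor H (LinearMap.mul' k H))
                ∘ₗ (LinearMap.rTensor H
                      (LinearMap.lTensor H (HopfAlgebra.antipode (R := k))))
                ∘ₗ (TensorProduct.assoc k H H H).symm.toLinearMap))
            ∘ₗ (TensorProduct.leftComm k H H (H ⊗[k] H)).toLinearMap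
            ∘ₗ (LinearMap.lTensor H (LinearMap.lTensor H (Coalgebra.comul (R := k))))
            ∘ₗ (LinearMap.lTensor H (Coalgebra.comul (R := k)))
            ∘ₗ (Coalgebra.comul (R := k))))

section

open LinearMap

theorem counit_apply_of_antipode_rightInverse (Sinv : H →ₗ[k] H)
    (hSinv : ∀ h : H, HopfAlgebra.antipode (R := k) (Sinv h) = h) (h : H) :
    Coalgebra.counit (R := k) (Sinv h) = Coalgebra.counit (R := k) h := by
  conv_rhs => rw [← hSinv h, HopfAlgebra.counit_antipode]

/-- The map `g ↦ g⁽¹⁾ ⊗ (S⁻¹(g⁽⁰⁾ S(g⁽²⁾)) ⊗ g⁽³⁾)`. -/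
def cpTwistedComul (Sinv : H →ₗ[k] H) : H →ₗ[k] H ⊗[k] (H ⊗[k] H) :=
  (LinearMap.lTensor H
      ((LinearMap.rTensor H Sinv)
        ∘ₗ (LinearMap.rTensor H (LinearMap.mul' k H))
        ∘ₗ (LinearMap.rTensor H
              (LinearMap.lTensor H (HopfAlgebra.antipode (R := k))))
        ∘ₗ (TensorProduct.assoc k H H H).symm.toLinearMap))
    ∘ₗ (TensorProduct.leftComm k H H (H ⊗[k] H)).toLinearMap
    ∘ₗ (LinearMap.lTensor H (LinearMap.lTensor H (Coalgebra.comul (R := k))))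
    ∘ₗ (LinearMap.lTensor H (Coalgebra.comul (R := k)))
    ∘ₗ (Coalgebra.comul (R := k))

theorem lid_rTensor_counit_cpTwistedComul (Sinv : H →ₗ[k] H) (hSinv : Sinv 1 = 1) (g : H) :
    TensorProduct.lid k (H ⊗[k] H)
      (rTensor (H ⊗[k] H) (Coalgebra.counit (R := k)) (cpTwistedComul Sinv g)) = 1 ⊗ₜ[k] g := by
  have hcontract : ∀ y : H ⊗[k] (H ⊗[k] H),
      TensorProduct.lid k (H ⊗[k] H) (rTensor (H ⊗[k] H) (Coalgebra.counit (R := k))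
        (lTensor H ((rTensor H Sinv) ∘ₗ (rTensor H (mul' k H))
            ∘ₗ (rTensor H (lTensor H (HopfAlgebra.antipode (R := k))))
            ∘ₗ (TensorProduct.assoc k H H H).symm.toLinearMap)
          (TensorProduct.leftComm k H H (H ⊗[k] H)
            (lTensor H (lTensor H (Coalgebra.comul (R := k))) y)))) =
      rTensor H Sinv (rTensor H (mul' k H)
        (rTensor H (lTensor H (HopfAlgebra.antipode (R := k)))
          ((TensorProduct.assoc k H H H).symm
            (lTensor H ((Coalgebra.comul (R := k)) ∘ₗ (TensorProduct.lid k H).toLinearMap ∘ₗ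
              rTensor H (Coalgebra.counit (R := k))) y)))) := by
    intro y
    induction y with
    | zero => simp
    | add x y hx hy => simp only [map_add, hx, hy]
    | tmul a y =>
      induction y with
      | zero => simp
      | add x y hx hy => simp only [TensorProduct.tmul_add, map_add, hx, hy]
      | tmul b c => simp [TensorProduct.tmul_smul]
  have hcounit : ((Coalgebra.comul (R := k)) ∘ₗ (TensorProduct.lid k H).toLinearMap ∘ₗ
      rTensor H (Coalgebra.counit (R := k))) ∘ₗ (Coalgebra.comul (R := k) (A := H)) =
      Coalgebra.comul (R := k) := by
    ext x
    simp
  simp only [cpTwistedComul, LinearMap.comp_apply, LinearEquiv.coe_coe]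
  rw [hcontract, ← lTensor_comp_apply, hcounit, Coalgebra.coassoc_symm_apply]
  simp only [← rTensor_comp_apply]
  rw [HopfAlgebra.mul_antipode_lTensor_comul]
  simp [LinearMap.rTensor_comp_apply, hSinv, Algebra.linearMap_apply]

theorem lTensor_counit_cpTwistedComul (Sinv : H →ₗ[k] H)
    (hSinv : ∀ h : H, Coalgebra.counit (R := k) (Sinv h) = Coalgebra.counit (R := k) h) (g : H) :
    lTensor H ((TensorProduct.lid k k).toLinearMap
        ∘ₗ TensorProduct.map (Coalgebra.counit (R := k)) (Coalgebra.counit (R := k)))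
      (cpTwistedComul Sinv g) = g ⊗ₜ[k] (1 : k) := by
  have hcontract : ∀ y : H ⊗[k] (H ⊗[k] (H ⊗[k] H)),
      lTensor H ((TensorProduct.lid k k).toLinearMap
          ∘ₗ TensorProduct.map (Coalgebra.counit (R := k)) (Coalgebra.counit (R := k)))
        (lTensor H ((rTensor H Sinv) ∘ₗ (rTensor H (mul' k H))
            ∘ₗ (rTensor H (lTensor H (HopfAlgebra.antipode (R := k))))
            ∘ₗ (TensorProduct.assoc k H H H).symm.toLinearMap)
          (TensorProduct.leftComm k H H (H ⊗[k] H) y)) =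
      lTensor H (Coalgebra.counit (R := k)) (TensorProduct.lid k (H ⊗[k] H)
        (rTensor (H ⊗[k] H) (Coalgebra.counit (R := k))
          (lTensor H (lTensor H ((TensorProduct.lid k H).toLinearMap ∘ₗ
              rTensor H (Coalgebra.counit (R := k)))) y))) := by
    intro y
    induction y with
    | zero => simp
    | add x y hx hy => simp only [map_add, hx, hy]
    | tmul a y =>
      induction y with
      | zero => simp
      | add x y hx hy => simp only [TensorProduct.tmul_add, map_add, hx, hy]
      | tmul b y =>
        induction y with
        | zero => simp
        | add x y hx hy => simp only [TensorProduct.tmul_add, map_add, hx, hy]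
        | tmul c d =>
          simp [hSinv, HopfAlgebra.counit_antipode, ← TensorProduct.tmul_smul, mul_assoc]
  have hcounit : ((TensorProduct.lid k H).toLinearMap ∘ₗ
      rTensor H (Coalgebra.counit (R := k))) ∘ₗ (Coalgebra.comul (R := k) (A := H)) =
      LinearMap.id := by
    ext x
    simp
  have hcomp : ∀ y : H ⊗[k] (H ⊗[k] H), lTensor H (lTensor H ((TensorProduct.lid k H).toLinearMap ∘ₗ
      rTensor H (Coalgebra.counit (R := k)))) (lTensor H (lTensor H (Coalgebra.comul (R := k))) y)
      = y := by
    intro y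
    rw [← lTensor_comp_apply, ← lTensor_comp, hcounit]
    simp
  simp only [cpTwistedComul, LinearMap.comp_apply, LinearEquiv.coe_coe]
  rw [hcontract, hcomp, ← LinearMap.comp_apply (rTensor _ _), rTensor_comp_lTensor,
    ← lTensor_comp_rTensor, LinearMap.comp_apply, Coalgebra.rTensor_counit_comul]
  simp

theorem cpComul_tmul (Sinv : H →ₗ[k] H) (act : H →ₗ[k] C →ₗ[k] C) (a : C) (g : H) :
    cpComul Sinv act (a ⊗ₜ g) =
      lTensor (C ⊗[k] H) ((rTensor H (TensorProduct.lift act))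
          ∘ₗ (TensorProduct.assoc k H C H).symm.toLinearMap
          ∘ₗ (TensorProduct.leftComm k C H H).toLinearMap)
        (TensorProduct.tensorTensorTensorComm k C C H (H ⊗[k] H)
          (Coalgebra.comul (R := k) a ⊗ₜ cpTwistedComul Sinv g)) :=
  rfl

theorem lid_rTensor_counit_tensorTensorTensorComm {D K : Type*} [AddCommGroup D] [Module k D]
    [AddCommGroup K] [Module k K] (f : C ⊗[k] D →ₗ[k] K) (z : C ⊗[k] C) (w : H ⊗[k] D) :
    TensorProduct.lid k K (rTensor K ((TensorProduct.lid k k).toLinearMap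
        ∘ₗ TensorProduct.map (Coalgebra.counit (R := k)) (Coalgebra.counit (R := k)))
      (lTensor (C ⊗[k] H) f (TensorProduct.tensorTensorTensorComm k C C H D (z ⊗ₜ w)))) =
    f (TensorProduct.lid k C (rTensor C (Coalgebra.counit (R := k)) z) ⊗ₜ
      TensorProduct.lid k D (rTensor D (Coalgebra.counit (R := k)) w)) := by
  induction z with
  | zero => simp
  | add x y hx hy => simp only [TensorProduct.add_tmul, map_add, hx, hy]
  | tmul a b =>
    induction w with
    | zero => simp
    | add x y hx hy => simp only [TensorProduct.tmul_add, map_add, hx, hy]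
    | tmul c d => simp [TensorProduct.smul_tmul, TensorProduct.tmul_smul, smul_smul, mul_comm]

theorem rid_lTensor_tensorTensorTensorComm {B D E G : Type*} [AddCommGroup B] [Module k B]
    [AddCommGroup D] [Module k D] [AddCommGroup E] [Module k E] [AddCommGroup G] [Module k G]
    (u : E →ₗ[k] k) (v : D →ₗ[k] k) (z : B ⊗[k] E) (w : G ⊗[k] D) :
    TensorProduct.rid k (B ⊗[k] G) (lTensor (B ⊗[k] G) ((TensorProduct.lid k k).toLinearMap
        ∘ₗ TensorProduct.map u v)
      (TensorProduct.tensorTensorTensorComm k B E G D (z ⊗ₜ w))) =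
    TensorProduct.rid k B (lTensor B u z) ⊗ₜ TensorProduct.rid k G (lTensor G v w) := by
  induction z with
  | zero => simp
  | add x y hx hy => simp only [TensorProduct.add_tmul, map_add, hx, hy]
  | tmul a b =>
    induction w with
    | zero => simp
    | add x y hx hy => simp only [TensorProduct.tmul_add, map_add, hx, hy]
    | tmul c d => simp [TensorProduct.smul_tmul, TensorProduct.tmul_smul, smul_smul, mul_comm]

end

/-- The map `ε_C ⊗ ε_H` is a counit for the crossed product
coalgebra `C >◀ H`: `((ε_C ⊗ ε_H) ⊗ id) ∘ Δ = id = (id ⊗ (ε_C ⊗ ε_H)) ∘ Δ`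
(composing with the unitor isomorphisms `k ⊗ (C ⊗ H) ≅ C ⊗ H ≅ (C ⊗ H) ⊗ k`). -/
theorem cpComul_counit
    (Sinv : H →ₗ[k] H)
    (hSinv₁ : ∀ h : H, Sinv (HopfAlgebra.antipode (R := k) h) = h)
    (hSinv₂ : ∀ h : H, HopfAlgebra.antipode (R := k) (Sinv h) = h)
    (act : H →ₗ[k] C →ₗ[k] C)
    (hact_one : act 1 = LinearMap.id)
    (hact_mul : ∀ g h : H, act (g * h) = act g ∘ₗ act h)
    (hact_comul : (Coalgebra.comul (R := k)) ∘ₗ TensorProduct.lift act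
      = (TensorProduct.map (TensorProduct.lift act) (TensorProduct.lift act))
          ∘ₗ (TensorProduct.tensorTensorTensorComm k H H C C).toLinearMap
          ∘ₗ (TensorProduct.map (Coalgebra.comul (R := k)) (Coalgebra.comul (R := k))))
    (hact_counit : (Coalgebra.counit (R := k)) ∘ₗ TensorProduct.lift act
      = (TensorProduct.lid k k).toLinearMap
          ∘ₗ TensorProduct.map (Coalgebra.counit (R := k)) (Coalgebra.counit (R := k))) :
    (TensorProduct.lid k (C ⊗[k] H)).toLinearMap
        ∘ₗ (LinearMap.rTensor (C ⊗[k] H)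
              ((TensorProduct.lid k k).toLinearMap
                ∘ₗ TensorProduct.map (Coalgebra.counit (R := k)) (Coalgebra.counit (R := k))))
        ∘ₗ (cpComul Sinv act) = LinearMap.id ∧
      (TensorProduct.rid k (C ⊗[k] H)).toLinearMap
          ∘ₗ (LinearMap.lTensor (C ⊗[k] H)
                ((TensorProduct.lid k k).toLinearMap
                  ∘ₗ TensorProduct.map (Coalgebra.counit (R := k)) (Coalgebra.counit (R := k))))
          ∘ₗ (cpComul Sinv act) = LinearMap.id := by
  have hone : Sinv 1 = 1 := by simpa using hSinv₁ 1
  have hcounit := counit_apply_of_antipode_rightInverse Sinv hSinv₂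
  constructor
  · refine TensorProduct.ext' fun a g => ?_
    simp only [LinearMap.comp_apply, LinearEquiv.coe_coe, cpComul_tmul, LinearMap.id_apply]
    have h := lid_rTensor_counit_tensorTensorTensorComm
      ((LinearMap.rTensor H (TensorProduct.lift act))
        ∘ₗ (TensorProduct.assoc k H C H).symm.toLinearMap
        ∘ₗ (TensorProduct.leftComm k C H H).toLinearMap) (Coalgebra.comul (R := k) a)
        (cpTwistedComul Sinv g)
    refine h.trans ?_
    rw [lid_rTensor_counit_cpTwistedComul Sinv hone]
    simp [hact_one]
  · refine TensorProduct.ext' fun a g => ?_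
    have hcomp : ((TensorProduct.lid k k).toLinearMap
          ∘ₗ TensorProduct.map (Coalgebra.counit (R := k)) (Coalgebra.counit (R := k)))
        ∘ₗ ((LinearMap.rTensor H (TensorProduct.lift act))
          ∘ₗ (TensorProduct.assoc k H C H).symm.toLinearMap
          ∘ₗ (TensorProduct.leftComm k C H H).toLinearMap) =
        (TensorProduct.lid k k).toLinearMap ∘ₗ TensorProduct.map (Coalgebra.counit (R := k))
          ((TensorProduct.lid k k).toLinearMap
          ∘ₗ TensorProduct.map (Coalgebra.counit (R := k)) (Coalgebra.counit (R := k))) := by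
      ext c x y
      have h : Coalgebra.counit (R := k) (act x c) =
          Coalgebra.counit (R := k) x * Coalgebra.counit (R := k) c := by
        simpa using LinearMap.congr_fun hact_counit (x ⊗ₜ c)
      simp [h, mul_assoc, mul_left_comm]
    simp only [LinearMap.comp_apply, LinearEquiv.coe_coe, cpComul_tmul, LinearMap.id_apply]
    rw [← LinearMap.lTensor_comp_apply, hcomp, rid_lTensor_tensorTensorTensorComm,
      lTensor_counit_cpTwistedComul Sinv hcounit]
    simp

end
end

section
/- Let t ∈ H be a right integral with ε(t) = 1, and let M be a left H-module. Define, for n ≥ 1, the bar boundary δ : H^{⊗n} ⊗ M → H^{⊗(n−1)} ⊗ M by δ(h_1, …, h_n, m) = ε(h_1)(h_2, …, h_n, m) + Σ_{i=1}^{n−1} (−1)^i (h_1, …, h_i h_{i+1}, …, h_n, m) + (−1)^n (h_1, …, h_{n−1}, h_n · m), and the homotopy h : H^{⊗n} ⊗ M → H^{⊗(n+1)} ⊗ M by h(h_1, …, h_n, m) = (t, h_1, …, h_n, m). Then for every n ≥ 1, δ ∘ h + h ∘ δ = id on H^{⊗n} ⊗ M. -/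
open TensorProduct Coalgebra

noncomputable section

variable {k : Type} [Field k]
variable {H : Type} [Ring H] [HopfAlgebra k H]
variable {M : Type} [AddCommGroup M] [Module k M]

/-- `H^{⊗n} ⊗ M` (right-nested), with `PM 0 = M`. -/
def PM (k : Type) [Field k] (H : Type) [Ring H] [HopfAlgebra k H]
    (M : Type) [AddCommGroup M] [Module k M] : ℕ → ModuleCat.{0} k
  | 0 => ModuleCat.of k M
  | n+1 => ModuleCat.of k (H ⊗[k] ↥(PM k H M n))

/-- `(h₁, h₂, …, m) ↦ ε(h₁) (h₂, …, m)`. -/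
def epsFirst (n : ℕ) : ↥(PM k H M (n+1)) →ₗ[k] ↥(PM k H M n) :=
  (TensorProduct.lid k ↥(PM k H M n)).toLinearMap
    ∘ₗ LinearMap.rTensor ↥(PM k H M n) (Coalgebra.counit (R := k))

/-- `(h₁, h₂, h₃, …, m) ↦ (h₁h₂, h₃, …, m)`. -/
def mulFirst (n : ℕ) : ↥(PM k H M (n+2)) →ₗ[k] ↥(PM k H M (n+1)) :=
  (LinearMap.rTensor ↥(PM k H M n) (LinearMap.mul' k H))
    ∘ₗ (TensorProduct.assoc k H H ↥(PM k H M n)).symm.toLinearMap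

section maps
variable (act : H →ₗ[k] M →ₗ[k] M)

/-- the bar boundary `δ(h₁, …, hₙ₊₁, m) = ε(h₁)(h₂,…,hₙ₊₁,m)
+ Σᵢ (−1)ⁱ (h₁,…,hᵢhᵢ₊₁,…,m) + (−1)ⁿ⁺¹ (h₁,…,hₙ, hₙ₊₁ · m)`. -/
def barDelta : ∀ n, ↥(PM k H M (n+1)) →ₗ[k] ↥(PM k H M n)
  | 0 => epsFirst 0 - TensorProduct.lift act
  | n+1 => epsFirst (n+1) - mulFirst n
      + LinearMap.lTensor H (epsFirst n) - LinearMap.lTensor H (barDelta n)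

/-- the homotopy `h(h₁,…,hₙ,m) = (t, h₁, …, hₙ, m)`. -/
def barHomotopy (t : H) (n : ℕ) : ↥(PM k H M n) →ₗ[k] ↥(PM k H M (n+1)) :=
  TensorProduct.mk k H ↥(PM k H M n) t

/-- Multiplying the first tensor factor by a right integral on the left applies the counit
to that factor. -/
theorem mulFirst_tmul_of_integral (t : H)
    (ht : ∀ h : H, t * h = (Coalgebra.counit (R := k) h) • t)
    (n : ℕ) (x : ↥(PM k H M (n+1))) :
    mulFirst (k := k) (H := H) (M := M) n (TensorProduct.mk k H ↥(PM k H M (n+1)) t x)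
      = TensorProduct.mk k H ↥(PM k H M n) t (epsFirst n x) := by
  refine LinearMap.congr_fun (f := mulFirst n ∘ₗ TensorProduct.mk k H ↥(PM k H M (n+1)) t)
    (g := TensorProduct.mk k H ↥(PM k H M n) t ∘ₗ epsFirst n) ?_ x
  refine TensorProduct.ext' fun h y => ?_
  change (t * h) ⊗ₜ[k] y = t ⊗ₜ[k] ((Coalgebra.counit (R := k) h) • y)
  rw [ht, TensorProduct.smul_tmul]

/-- If `t` is a right integral in `H` with `ε(t) = 1` and `M` is a left
`H`-module, then `δ ∘ h + h ∘ δ = id` on `H^{⊗n} ⊗ M` for every `n ≥ 1`. -/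
theorem barDelta_homotopy
    (act : H →ₗ[k] M →ₗ[k] M)
    (hact_one : act 1 = LinearMap.id)
    (hact_mul : ∀ g h : H, act (g * h) = act g ∘ₗ act h)
    (t : H)
    (ht : ∀ h : H, t * h = (Coalgebra.counit (R := k) h) • t)
    (hεt : Coalgebra.counit (R := k) t = 1)
    (n : ℕ) :
    barDelta act (n+1) ∘ₗ barHomotopy t (n+1) + barHomotopy t n ∘ₗ barDelta act n
      = LinearMap.id := by
  refine LinearMap.ext fun x => ?_
  have hε : epsFirst (n+1) (barHomotopy t (n+1) x) = x := by
    change (Coalgebra.counit (R := k) t) • x = x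
    rw [hεt, one_smul]
  change epsFirst (n+1) (barHomotopy t (n+1) x) - mulFirst n (barHomotopy t (n+1) x)
      + barHomotopy t n (epsFirst n x) - barHomotopy t n (barDelta act n x)
      + barHomotopy t n (barDelta act n x) = x
  have hmul : mulFirst n (barHomotopy t (n+1) x) = barHomotopy t n (epsFirst n x) :=
    mulFirst_tmul_of_integral t ht n x
  rw [hε, hmul, sub_add_cancel, sub_add_cancel]

end maps
end
end

section
/- The formula 𝚫(g | a_0, …, a_n) = (S(g^{(4)}) g^{(1)}) ⊗ (g^{(3)} | (g^{(2)} S^{-1}(g^{(0)})) · (a_0, …, a_n)) defines a left H-comodule structure on H ⊗ C^{⊗(n+1)}: (ε ⊗ id) ∘ 𝚫 = id and (Δ ⊗ id) ∘ 𝚫 = (id ⊗ 𝚫) ∘ 𝚫. -/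
open TensorProduct Coalgebra

noncomputable section

variable {k : Type} [CommRing k]
variable {H : Type} [Ring H] [HopfAlgebra k H]

def Pw (k : Type) [CommRing k] (M : ModuleCat.{0} k) : ℕ → ModuleCat.{0} k
  | 0 => M
  | n+1 => ModuleCat.of k (↥M ⊗[k] ↥(Pw k M n))

def dact (M : ModuleCat.{0} k) (μ : (H ⊗[k] ↥M) →ₗ[k] ↥M) :
    ∀ n, (H ⊗[k] ↥(Pw k M n)) →ₗ[k] ↥(Pw k M n)
  | 0 => μ
  | n+1 =>
      (TensorProduct.map μ (dact M μ n))
        ∘ₗ (TensorProduct.tensorTensorTensorComm k H H ↥M ↥(Pw k M n)).toLinearMap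
        ∘ₗ (LinearMap.rTensor (↥M ⊗[k] ↥(Pw k M n)) (Coalgebra.comul (R := k)))

/-- the iterated comultiplication `g ↦ g⁽⁰⁾ ⊗ (g⁽¹⁾ ⊗ (g⁽²⁾ ⊗ (g⁽³⁾ ⊗ g⁽⁴⁾)))`. -/
def delta4 : H →ₗ[k] (H ⊗[k] (H ⊗[k] (H ⊗[k] (H ⊗[k] H)))) :=
  (LinearMap.lTensor H (LinearMap.lTensor H (LinearMap.lTensor H (Coalgebra.comul (R := k)))))
    ∘ₗ (LinearMap.lTensor H (LinearMap.lTensor H (Coalgebra.comul (R := k))))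
    ∘ₗ (LinearMap.lTensor H (Coalgebra.comul (R := k)))
    ∘ₗ (Coalgebra.comul (R := k))

/-- `g⁽⁰⁾ ⊗ (g⁽¹⁾ ⊗ (g⁽²⁾ ⊗ (g⁽³⁾ ⊗ g⁽⁴⁾)))
  ↦ (S(g⁽⁴⁾)g⁽¹⁾) ⊗ (g⁽³⁾ ⊗ (g⁽²⁾S⁻¹(g⁽⁰⁾)))`. -/
def wAux (Sinv : H →ₗ[k] H) :
    (H ⊗[k] (H ⊗[k] (H ⊗[k] (H ⊗[k] H)))) →ₗ[k] (H ⊗[k] (H ⊗[k] H)) :=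
  (TensorProduct.leftComm k H H H).toLinearMap
    ∘ₗ (LinearMap.lTensor H (TensorProduct.comm k H H).toLinearMap)
    ∘ₗ (TensorProduct.leftComm k H H H).toLinearMap
    ∘ₗ (LinearMap.lTensor H
          ((LinearMap.lTensor H
              (LinearMap.mul' k H ∘ₗ (TensorProduct.comm k H H).toLinearMap))
            ∘ₗ (TensorProduct.leftComm k H H H).toLinearMap))
    ∘ₗ (LinearMap.rTensor (H ⊗[k] (H ⊗[k] H))
          (LinearMap.mul' k H ∘ₗ (TensorProduct.comm k H H).toLinearMap))
    ∘ₗ (TensorProduct.tensorTensorTensorComm k H H H (H ⊗[k] H)).toLinearMap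
    ∘ₗ (TensorProduct.assoc k H H (H ⊗[k] (H ⊗[k] H))).symm.toLinearMap
    ∘ₗ (LinearMap.lTensor H (LinearMap.lTensor H (LinearMap.lTensor H
          (LinearMap.lTensor H (HopfAlgebra.antipode (R := k))))))
    ∘ₗ (LinearMap.rTensor (H ⊗[k] (H ⊗[k] (H ⊗[k] H))) Sinv)

variable {C : Type} [AddCommGroup C] [Module k C] [Coalgebra k C]

/-- the coaction `𝚫(g | a₀,…,aₙ)
  = (S(g⁽⁴⁾)g⁽¹⁾) ⊗ (g⁽³⁾ | (g⁽²⁾S⁻¹(g⁽⁰⁾)) · (a₀,…,aₙ))` on `H ⊗ C^{⊗(n+1)}`. -/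
def bigDelta (Sinv : H →ₗ[k] H) (act : H →ₗ[k] C →ₗ[k] C) (n : ℕ) :
    (H ⊗[k] ↥(Pw k (ModuleCat.of k C) n)) →ₗ[k]
      (H ⊗[k] (H ⊗[k] ↥(Pw k (ModuleCat.of k C) n))) :=
  (LinearMap.lTensor H (LinearMap.lTensor H
      (dact (ModuleCat.of k C) (TensorProduct.lift act) n)))
    ∘ₗ (LinearMap.lTensor H
          (TensorProduct.assoc k H H ↥(Pw k (ModuleCat.of k C) n)).toLinearMap)
    ∘ₗ (TensorProduct.assoc k H (H ⊗[k] H) ↥(Pw k (ModuleCat.of k C) n)).toLinearMap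
    ∘ₗ (LinearMap.rTensor ↥(Pw k (ModuleCat.of k C) n) (wAux Sinv))
    ∘ₗ (LinearMap.rTensor ↥(Pw k (ModuleCat.of k C) n) delta4)

namespace BigDelta

open WithConv MulOpposite

/-! ### Diagonal actions -/

section Action

lemma dact_succ_tmul (M : ModuleCat.{0} k) (μ : (H ⊗[k] ↥M) →ₗ[k] ↥M) (n : ℕ) (g : H)
    (z : ↥M ⊗[k] ↥(Pw k M n)) :
    dact M μ (n + 1) (g ⊗ₜ[k] (show ↥(Pw k M (n + 1)) from z)) =
      TensorProduct.map μ (dact M μ n)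
        (TensorProduct.tensorTensorTensorComm k H H ↥M ↥(Pw k M n)
          ((Coalgebra.comul (R := k) g) ⊗ₜ[k] z)) := rfl

lemma map_tensorTensorTensorComm_mul {M N : Type} [AddCommGroup M] [Module k M]
    [AddCommGroup N] [Module k N] (μ : (H ⊗[k] M) →ₗ[k] M) (ν : (H ⊗[k] N) →ₗ[k] N)
    (hμ : ∀ (g h : H) (m : M), μ ((g * h) ⊗ₜ m) = μ (g ⊗ₜ μ (h ⊗ₜ m)))
    (hν : ∀ (g h : H) (m : N), ν ((g * h) ⊗ₜ m) = ν (g ⊗ₜ ν (h ⊗ₜ m)))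
    (x y : H ⊗[k] H) (z : M ⊗[k] N) :
    TensorProduct.map μ ν (TensorProduct.tensorTensorTensorComm k H H M N ((x * y) ⊗ₜ[k] z)) =
      TensorProduct.map μ ν (TensorProduct.tensorTensorTensorComm k H H M N (x ⊗ₜ[k]
        TensorProduct.map μ ν (TensorProduct.tensorTensorTensorComm k H H M N (y ⊗ₜ[k] z)))) := by
  induction x with
  | zero => simp
  | add x₁ x₂ h₁ h₂ => simp only [add_mul, TensorProduct.add_tmul, map_add, h₁, h₂]
  | tmul a b =>
    induction y with
    | zero => simp
    | add y₁ y₂ h₁ h₂ =>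
      simp only [mul_add, TensorProduct.add_tmul, TensorProduct.tmul_add, map_add, h₁, h₂]
    | tmul c d =>
      induction z with
      | zero => simp
      | add z₁ z₂ h₁ h₂ => simp only [TensorProduct.tmul_add, map_add, h₁, h₂]
      | tmul m n => simp [hμ, hν]

lemma dact_mul (M : ModuleCat.{0} k) (μ : (H ⊗[k] ↥M) →ₗ[k] ↥M)
    (hμ : ∀ (g h : H) (m : ↥M), μ ((g * h) ⊗ₜ m) = μ (g ⊗ₜ μ (h ⊗ₜ m))) :
    ∀ (n : ℕ) (g h : H) (m : ↥(Pw k M n)),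
      dact M μ n ((g * h) ⊗ₜ m) = dact M μ n (g ⊗ₜ dact M μ n (h ⊗ₜ m))
  | 0, g, h, m => hμ g h m
  | n + 1, g, h, m => by
    have := map_tensorTensorTensorComm_mul μ (dact M μ n) hμ (dact_mul M μ hμ n)
      (Coalgebra.comul (R := k) g) (Coalgebra.comul (R := k) h) m
    rw [← Bialgebra.comul_mul] at this
    exact this

lemma dact_one (M : ModuleCat.{0} k) (μ : (H ⊗[k] ↥M) →ₗ[k] ↥M)
    (hμ : ∀ m : ↥M, μ ((1 : H) ⊗ₜ m) = m) :
    ∀ (n : ℕ) (m : ↥(Pw k M n)), dact M μ n ((1 : H) ⊗ₜ m) = m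
  | 0, m => hμ m
  | n + 1, m => by
    refine (dact_succ_tmul M μ n 1 m).trans ?_
    rw [Bialgebra.comul_one, Algebra.TensorProduct.one_def]
    change ↥M ⊗[k] ↥(Pw k M n) at m
    induction m with
    | zero => simp; rfl
    | add z₁ z₂ h₁ h₂ => rw [TensorProduct.tmul_add, map_add, map_add, h₁, h₂]
    | tmul a b => simp [hμ, dact_one M μ hμ n]; rfl

end Action

/-! ### Convolution products -/

section Convolution

variable {A B : Type} [Semiring A] [Algebra k A] [Semiring B] [Algebra k B]

/-- Postcomposition with an algebra map, on the convolution algebra. -/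
def convMap (h : A →ₐ[k] B) (f : WithConv (H →ₗ[k] A)) : WithConv (H →ₗ[k] B) :=
  toConv (h.toLinearMap ∘ₗ f.ofConv)

lemma convMap_apply (h : A →ₐ[k] B) (f : WithConv (H →ₗ[k] A)) (g : H) :
    convMap h f g = h (f g) := rfl

lemma convMap_mul (h : A →ₐ[k] B) (f g : WithConv (H →ₗ[k] A)) :
    convMap h (f * g) = convMap h f * convMap h g :=
  WithConv.ext (LinearMap.algHom_comp_convMul_distrib h f g)

lemma convMap_one (h : A →ₐ[k] B) : convMap h (1 : WithConv (H →ₗ[k] A)) = 1 := by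
  ext g
  exact h.commutes _

/-- The five-fold convolution product is computed by `delta4`. -/
lemma convMul_five_apply (f₀ f₁ f₂ f₃ f₄ : WithConv (H →ₗ[k] A)) (g : H) :
    (f₀ * (f₁ * (f₂ * (f₃ * f₄)))) g =
      (LinearMap.mul' k A ∘ₗ TensorProduct.map f₀.ofConv
        (LinearMap.mul' k A ∘ₗ TensorProduct.map f₁.ofConv
          (LinearMap.mul' k A ∘ₗ TensorProduct.map f₂.ofConv
            (LinearMap.mul' k A ∘ₗ TensorProduct.map f₃.ofConv f₄.ofConv)))) (delta4 g) := by
  have key {V W : Type} [AddCommGroup V] [Module k V] [AddCommGroup W] [Module k W]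
      (f : H →ₗ[k] A) (L : W →ₗ[k] A) (D : V →ₗ[k] W) :
      TensorProduct.map f (L ∘ₗ D) = TensorProduct.map f L ∘ₗ LinearMap.lTensor H D := by
    ext; simp
  simp only [LinearMap.convMul_def, ofConv_toConv, key, ← LinearMap.comp_assoc, delta4]
  rfl

end Convolution

/-! ### The antipode and the comultiplication -/

section Antipode

/-- The antipode reverses the comultiplication. -/
lemma comul_antipode (g : H) :
    Coalgebra.comul (R := k) (HopfAlgebra.antipode k g) =
      TensorProduct.comm k H H (TensorProduct.map (HopfAlgebra.antipode k)
        (HopfAlgebra.antipode k) (Coalgebra.comul (R := k) g)) := by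
  let e₁ : H →ₐ[k] H ⊗[k] H := Algebra.TensorProduct.includeLeft
  let e₂ : H →ₐ[k] H ⊗[k] H := Algebra.TensorProduct.includeRight
  let x : WithConv (H →ₗ[k] H) := toConv LinearMap.id
  let s : WithConv (H →ₗ[k] H) := toConv (HopfAlgebra.antipode k)
  have hxs : x * s = 1 := LinearMap.id_mul_antipode
  have hsx : s * x = 1 := LinearMap.antipode_mul_id
  have hx : convMap e₁ x * convMap e₂ x = convMap (Bialgebra.comulAlgHom k H) x := by
    ext g
    have (t : H ⊗[k] H) : LinearMap.mul' k _ (TensorProduct.map (convMap e₁ x).ofConv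
        (convMap e₂ x).ofConv t) = t := by
      induction t with
      | zero => simp
      | add a b ha hb => rw [map_add, map_add, ha, hb]
      | tmul a b => simp [convMap, e₁, e₂, x]
    exact this _
  have hs : convMap (Bialgebra.comulAlgHom k H) s = convMap e₂ s * convMap e₁ s := by
    refine left_inv_eq_right_inv (a := convMap (Bialgebra.comulAlgHom k H) x) ?_ ?_
    · rw [← convMap_mul, hsx, convMap_one]
    · rw [← hx, mul_assoc, ← mul_assoc (convMap e₂ x), ← convMap_mul, hxs, convMap_one, one_mul,
        ← convMap_mul, hxs, convMap_one]
  have (t : H ⊗[k] H) : LinearMap.mul' k _ (TensorProduct.map (convMap e₂ s).ofConv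
      (convMap e₁ s).ofConv t) = TensorProduct.comm k H H (TensorProduct.map
        (HopfAlgebra.antipode k) (HopfAlgebra.antipode k) t) := by
    induction t with
    | zero => simp
    | add a b ha hb => simp only [map_add, ha, hb]
    | tmul a b => simp [convMap, e₁, e₂, s]
  exact (congrArg (fun f => f.ofConv g) hs).trans (this _)

variable (k H) in
/-- The comultiplication as an algebra map on the opposite algebra. -/
def opComul : Hᵐᵒᵖ →ₐ[k] Hᵐᵒᵖ ⊗[k] Hᵐᵒᵖ :=
  AlgHom.ofLinearMap (Coalgebra.comul (R := k) (A := Hᵐᵒᵖ))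
    (by simp [MulOpposite.comul_def, Algebra.TensorProduct.one_def])
    (by
      have key (s t : H ⊗[k] H) :
          TensorProduct.map (opLinearEquiv k : H ≃ₗ[k] Hᵐᵒᵖ).toLinearMap
            (opLinearEquiv k : H ≃ₗ[k] Hᵐᵒᵖ).toLinearMap (s * t) =
          TensorProduct.map (opLinearEquiv k : H ≃ₗ[k] Hᵐᵒᵖ).toLinearMap
            (opLinearEquiv k : H ≃ₗ[k] Hᵐᵒᵖ).toLinearMap t *
          TensorProduct.map (opLinearEquiv k : H ≃ₗ[k] Hᵐᵒᵖ).toLinearMap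
            (opLinearEquiv k : H ≃ₗ[k] Hᵐᵒᵖ).toLinearMap s := by
        induction s with
        | zero => simp
        | add a b ha hb => simp only [add_mul, mul_add, map_add, ha, hb]
        | tmul a b =>
          induction t with
          | zero => simp
          | add c d hc hd => simp only [add_mul, mul_add, map_add, hc, hd]
          | tmul c d => simp
      intro a b
      simpa [MulOpposite.comul_def] using
        key (Coalgebra.comul (R := k) b.unop) (Coalgebra.comul (R := k) a.unop))

lemma opComul_op (g : H) :
    opComul k H (op g) = TensorProduct.map (opLinearEquiv k : H ≃ₗ[k] Hᵐᵒᵖ).toLinearMap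
      (opLinearEquiv k : H ≃ₗ[k] Hᵐᵒᵖ).toLinearMap (Coalgebra.comul (R := k) g) := rfl

variable (k H) in
/-- The counit as an algebra map on the opposite algebra. -/
def opCounit : Hᵐᵒᵖ →ₐ[k] k :=
  (Bialgebra.counitAlgHom k H).fromOpposite fun _ _ => Commute.all _ _

lemma opCounit_op (g : H) : opCounit k H (op g) = Coalgebra.counit (R := k) g := rfl

variable (k H) in
/-- The identity as a map to the opposite algebra. -/
def opConv : WithConv (H →ₗ[k] Hᵐᵒᵖ) := toConv (opLinearEquiv k : H ≃ₗ[k] Hᵐᵒᵖ).toLinearMap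

/-- A linear endomorphism as a map to the opposite algebra. -/
def opConvOf (f : H →ₗ[k] H) : WithConv (H →ₗ[k] Hᵐᵒᵖ) :=
  toConv ((opLinearEquiv k : H ≃ₗ[k] Hᵐᵒᵖ).toLinearMap ∘ₗ f)

lemma antipodeInv_algebraMap (Sinv : H →ₗ[k] H)
    (hSinv₁ : ∀ h : H, Sinv (HopfAlgebra.antipode (R := k) h) = h) (c : k) :
    Sinv (algebraMap k H c) = algebraMap k H c := by
  have h := hSinv₁ 1
  rw [HopfAlgebra.antipode_one] at h
  rw [Algebra.algebraMap_eq_smul_one, map_smul, h]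

lemma opConv_mul_opConvOf_antipodeInv (Sinv : H →ₗ[k] H)
    (hSinv₁ : ∀ h : H, Sinv (HopfAlgebra.antipode (R := k) h) = h)
    (hSinv₂ : ∀ h : H, HopfAlgebra.antipode (R := k) (Sinv h) = h) :
    opConv k H * opConvOf Sinv = 1 := by
  ext g
  have (t : H ⊗[k] H) : LinearMap.mul' k _ (TensorProduct.map (opConv k H).ofConv
      (opConvOf Sinv).ofConv t) = op (Sinv (LinearMap.mul' k H
        (LinearMap.rTensor H (HopfAlgebra.antipode k) t))) := by
    induction t with
    | zero => simp
    | add a b ha hb => simp only [map_add, ha, hb, op_add]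
    | tmul a b =>
      have : HopfAlgebra.antipode k (Sinv b * a) = HopfAlgebra.antipode k a * b := by
        rw [HopfAlgebra.antipode_mul_antidistrib, hSinv₂]
      simp [opConv, opConvOf, ← this, hSinv₁]
  refine (this _).trans ?_
  rw [HopfAlgebra.mul_antipode_rTensor_comul_apply, antipodeInv_algebraMap Sinv hSinv₁]
  rfl

lemma opConvOf_antipodeInv_mul_opConv (Sinv : H →ₗ[k] H)
    (hSinv₁ : ∀ h : H, Sinv (HopfAlgebra.antipode (R := k) h) = h)
    (hSinv₂ : ∀ h : H, HopfAlgebra.antipode (R := k) (Sinv h) = h) :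
    opConvOf Sinv * opConv k H = 1 := by
  ext g
  have (t : H ⊗[k] H) : LinearMap.mul' k _ (TensorProduct.map (opConvOf Sinv).ofConv
      (opConv k H).ofConv t) = op (Sinv (LinearMap.mul' k H
        (LinearMap.lTensor H (HopfAlgebra.antipode k) t))) := by
    induction t with
    | zero => simp
    | add a b ha hb => simp only [map_add, ha, hb, op_add]
    | tmul a b =>
      have : HopfAlgebra.antipode k (b * Sinv a) = a * HopfAlgebra.antipode k b := by
        rw [HopfAlgebra.antipode_mul_antidistrib, hSinv₂]
      simp [opConv, opConvOf, ← this, hSinv₁]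
  refine (this _).trans ?_
  rw [HopfAlgebra.mul_antipode_lTensor_comul_apply, antipodeInv_algebraMap Sinv hSinv₁]
  rfl

end Antipode

/-! ### The coaction as a convolution product -/

section Coaction

open Algebra.TensorProduct

variable (k H) in
/-- The algebra `Hᵒᵖ ⊗ (H ⊗ Hᵒᵖ)` of coefficients of the coaction. -/
abbrev Coeff : Type := Hᵐᵒᵖ ⊗[k] (H ⊗[k] Hᵐᵒᵖ)

variable (k H) in
/-- The algebra `(Hᵒᵖ ⊗ Hᵒᵖ) ⊗ (H ⊗ Hᵒᵖ)` of coefficients of the iterated coaction. -/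
abbrev Coeff₂ : Type := (Hᵐᵒᵖ ⊗[k] Hᵐᵒᵖ) ⊗[k] (H ⊗[k] Hᵐᵒᵖ)

instance : NonUnitalNonAssocSemiring (Coeff₂ k H) := inferInstance

variable (k H) in
/-- The inclusion of the first factor. -/
def fstHom : Hᵐᵒᵖ →ₐ[k] Coeff k H := includeLeft

variable (k H) in
/-- The inclusion of the middle factor. -/
def midHom : H →ₐ[k] Coeff k H := includeRight.comp includeLeft

variable (k H) in
/-- The inclusion of the last factor. -/
def lastHom : Hᵐᵒᵖ →ₐ[k] Coeff k H := includeRight.comp includeRight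

/-- The convolution product
`g ↦ (S(g⁽⁴⁾)g⁽¹⁾) ⊗ (g⁽³⁾ ⊗ (g⁽²⁾S⁻¹(g⁽⁰⁾)))`. -/
def coactConv (Sinv : H →ₗ[k] H) : WithConv (H →ₗ[k] Coeff k H) :=
  convMap (lastHom k H) (opConvOf Sinv) * (convMap (fstHom k H) (opConv k H) *
    (convMap (lastHom k H) (opConv k H) * (convMap (midHom k H) (toConv LinearMap.id) *
      convMap (fstHom k H) (opConvOf (HopfAlgebra.antipode k)))))

variable (k H) in
/-- Forget the opposite multiplications. -/
def unopCoeff : Coeff k H →ₗ[k] H ⊗[k] (H ⊗[k] H) :=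
  TensorProduct.map (opLinearEquiv k : H ≃ₗ[k] Hᵐᵒᵖ).symm.toLinearMap
    (LinearMap.lTensor H (opLinearEquiv k : H ≃ₗ[k] Hᵐᵒᵖ).symm.toLinearMap)

lemma wAux_tmul (Sinv : H →ₗ[k] H) (a b c d e : H) :
    wAux Sinv (a ⊗ₜ (b ⊗ₜ (c ⊗ₜ (d ⊗ₜ e)))) =
      (HopfAlgebra.antipode k e * b) ⊗ₜ (d ⊗ₜ (c * Sinv a)) := by
  simp [wAux]

lemma wAux_delta4 (Sinv : H →ₗ[k] H) (g : H) :
    wAux Sinv (delta4 g) = unopCoeff k H (coactConv Sinv g) := by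
  rw [coactConv, convMul_five_apply]
  rw [← LinearMap.comp_apply (unopCoeff k H)]
  congr 1
  ext a b c d e
  simp [wAux_tmul, convMap, opConv, opConvOf, fstHom, midHom, lastHom, unopCoeff]

variable (k H) in
/-- The inclusion of the last three factors. -/
def inclHom : Coeff k H →ₐ[k] Coeff₂ k H :=
  Algebra.TensorProduct.map includeRight (AlgHom.id k _)

variable (k H) in
/-- The inclusion of the first factor. -/
def fstHom₂ : Hᵐᵒᵖ →ₐ[k] Coeff₂ k H := includeLeft.comp includeLeft

variable (k H) in
/-- The comultiplication on the first factor. -/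
def comulHom : Coeff k H →ₐ[k] Coeff₂ k H :=
  Algebra.TensorProduct.map (opComul k H) (AlgHom.id k _)

/-- The substitution `u ⊗ (v ⊗ w) ↦ u ⊗ (w · coactConv v)`. -/
def iterate (Sinv : H →ₗ[k] H) : Coeff k H →ₗ[k] Coeff₂ k H :=
  LinearMap.mul' k (Coeff₂ k H) ∘ₗ TensorProduct.map (fstHom₂ k H).toLinearMap
    (LinearMap.mul' k (Coeff₂ k H) ∘ₗ TensorProduct.map ((inclHom k H).comp (lastHom k H)).toLinearMap
      ((inclHom k H).toLinearMap ∘ₗ (coactConv Sinv).ofConv) ∘ₗ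
        (TensorProduct.comm k H Hᵐᵒᵖ).toLinearMap)

lemma fstHom₂_mul_inclHom (u : Hᵐᵒᵖ) (x : Coeff k H) :
    fstHom₂ k H u * inclHom k H x = inclHom k H x * fstHom₂ k H u := by
  induction x using TensorProduct.induction_on with
  | zero => simp
  | add x y hx hy => rw [map_add, mul_add, add_mul, hx, hy]
  | tmul a b => simp [fstHom₂, inclHom]

lemma iterate_tmul (Sinv : H →ₗ[k] H) (u w : Hᵐᵒᵖ) (v : H) :
    iterate Sinv (u ⊗ₜ (v ⊗ₜ w)) =
      fstHom₂ k H u * (inclHom k H (lastHom k H w) * inclHom k H (coactConv Sinv v)) := rfl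

lemma mul_mul_mul_mul_of_commute {R : Type} [Monoid R] {b e x y z : R} (hb : Commute b x)
    (hx : Commute e x) (hy : Commute e y) (hz : Commute e z) :
    b * e * (x * y * z) = x * (b * (y * (z * e))) := by
  rw [mul_assoc b, ((hx.mul_right hy).mul_right hz).eq, mul_assoc x, mul_assoc x,
    ← mul_assoc b, hb.eq]
  simp only [mul_assoc]

lemma iterate_coactConv (Sinv : H →ₗ[k] H) (g : H) :
    iterate Sinv (coactConv Sinv g) =
      (convMap (inclHom k H) (convMap (lastHom k H) (opConvOf Sinv)) *
        (convMap (fstHom₂ k H) (opConv k H) *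
          (convMap (inclHom k H) (convMap (lastHom k H) (opConv k H)) *
            (convMap (inclHom k H) (coactConv Sinv) *
              convMap (fstHom₂ k H) (opConvOf (HopfAlgebra.antipode k)))))) g := by
  rw [coactConv, convMul_five_apply, ← coactConv, convMul_five_apply]
  rw [← LinearMap.comp_apply (iterate Sinv)]
  congr 1
  ext a b c d e
  have h (u : Hᵐᵒᵖ) (x : Coeff k H) : Commute (fstHom₂ k H u) (inclHom k H x) :=
    fstHom₂_mul_inclHom u x
  have hp : ((convMap (lastHom k H) (opConvOf Sinv)) a * ((convMap (fstHom k H) (opConv k H)) b *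
      ((convMap (lastHom k H) (opConv k H)) c * ((convMap (midHom k H) (toConv LinearMap.id)) d *
      (convMap (fstHom k H) (opConvOf (HopfAlgebra.antipode k))) e)))) =
      (op b * op (HopfAlgebra.antipode k e)) ⊗ₜ[k] (d ⊗ₜ[k] (op (Sinv a) * op c)) := by
    simp [convMap, opConv, opConvOf, fstHom, midHom, lastHom]
  refine (congrArg (iterate Sinv) hp).trans ?_
  rw [iterate_tmul, map_mul (fstHom₂ k H), map_mul (lastHom k H), map_mul (inclHom k H)]
  exact mul_mul_mul_mul_of_commute (R := Coeff₂ k H) (h _ _) (h _ _) (h _ _) (h _ _)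

lemma comulHom_coactConv (Sinv : H →ₗ[k] H)
    (hSinv₁ : ∀ h : H, Sinv (HopfAlgebra.antipode (R := k) h) = h)
    (hSinv₂ : ∀ h : H, HopfAlgebra.antipode (R := k) (Sinv h) = h) (g : H) :
    comulHom k H (coactConv Sinv g) = iterate Sinv (coactConv Sinv g) := by
  have h₁ : convMap (comulHom k H) (convMap (fstHom k H) (opConv k H)) =
      convMap (fstHom₂ k H) (opConv k H) *
        convMap (inclHom k H) (convMap (fstHom k H) (opConv k H)) := by
    ext g
    have (t : H ⊗[k] H) : (TensorProduct.map (opLinearEquiv k : H ≃ₗ[k] Hᵐᵒᵖ).toLinearMap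
        (opLinearEquiv k : H ≃ₗ[k] Hᵐᵒᵖ).toLinearMap t) ⊗ₜ[k] (1 : H ⊗[k] Hᵐᵒᵖ) =
          LinearMap.mul' k (Coeff₂ k H) (TensorProduct.map (convMap (fstHom₂ k H) (opConv k H)).ofConv
          (convMap (inclHom k H) (convMap (fstHom k H) (opConv k H))).ofConv t) := by
      induction t with
      | zero => simp
      | add a b ha hb => simp only [map_add, TensorProduct.add_tmul, ha, hb]
      | tmul a b => simp [convMap, opConv, fstHom, fstHom₂, inclHom]
    rw [LinearMap.convMul_apply, ← this, ← opComul_op]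
    simp [convMap, opConv, fstHom, comulHom]
  have h₂ : convMap (comulHom k H) (convMap (fstHom k H) (opConvOf (HopfAlgebra.antipode k))) =
      convMap (inclHom k H) (convMap (fstHom k H) (opConvOf (HopfAlgebra.antipode k))) *
        convMap (fstHom₂ k H) (opConvOf (HopfAlgebra.antipode k)) := by
    ext g
    have (t : H ⊗[k] H) : (TensorProduct.map (opLinearEquiv k : H ≃ₗ[k] Hᵐᵒᵖ).toLinearMap
        (opLinearEquiv k : H ≃ₗ[k] Hᵐᵒᵖ).toLinearMap (TensorProduct.comm k H H
          (TensorProduct.map (HopfAlgebra.antipode k) (HopfAlgebra.antipode k) t))) ⊗ₜ[k]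
            (1 : H ⊗[k] Hᵐᵒᵖ) =
        LinearMap.mul' k (Coeff₂ k H) (TensorProduct.map (convMap (inclHom k H) (convMap (fstHom k H)
          (opConvOf (HopfAlgebra.antipode k)))).ofConv
          (convMap (fstHom₂ k H) (opConvOf (HopfAlgebra.antipode k))).ofConv t) := by
      induction t with
      | zero => simp
      | add a b ha hb => simp only [map_add, TensorProduct.add_tmul, ha, hb]
      | tmul a b => simp [convMap, opConvOf, fstHom, fstHom₂, inclHom]
    rw [LinearMap.convMul_apply, ← this, ← comul_antipode, ← opComul_op]
    simp [convMap, opConvOf, fstHom, comulHom]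
  have h₃ (f : WithConv (H →ₗ[k] Hᵐᵒᵖ)) : convMap (comulHom k H) (convMap (lastHom k H) f) =
      convMap (inclHom k H) (convMap (lastHom k H) f) := by
    ext g
    simp [convMap, comulHom, inclHom, lastHom, Algebra.TensorProduct.one_def]
  have h₄ (f : WithConv (H →ₗ[k] H)) : convMap (comulHom k H) (convMap (midHom k H) f) =
      convMap (inclHom k H) (convMap (midHom k H) f) := by
    ext g
    simp [convMap, comulHom, inclHom, midHom, Algebra.TensorProduct.one_def]
  have h₅ : convMap (inclHom k H) (convMap (lastHom k H) (opConv k H)) *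
      convMap (inclHom k H) (convMap (lastHom k H) (opConvOf Sinv)) = 1 := by
    rw [← convMap_mul, ← convMap_mul, opConv_mul_opConvOf_antipodeInv Sinv hSinv₁ hSinv₂,
      convMap_one, convMap_one]
  rw [iterate_coactConv, ← convMap_apply]
  congr 2
  nth_rw 2 [coactConv]
  rw [coactConv]
  simp only [convMap_mul, h₁, h₂, h₃, h₄]
  simp only [← mul_assoc]
  congr 5
  rw [mul_assoc _ _ (convMap (inclHom k H) (convMap (lastHom k H) (opConvOf Sinv))), h₅, mul_one]

variable (k H) in
/-- The counit on the first factor. -/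
def counitHom : Coeff k H →ₐ[k] H ⊗[k] Hᵐᵒᵖ :=
  (Algebra.TensorProduct.lid k (H ⊗[k] Hᵐᵒᵖ)).toAlgHom.comp
    (Algebra.TensorProduct.map (opCounit k H) (AlgHom.id k _))

lemma counitHom_coactConv (Sinv : H →ₗ[k] H)
    (hSinv₁ : ∀ h : H, Sinv (HopfAlgebra.antipode (R := k) h) = h)
    (hSinv₂ : ∀ h : H, HopfAlgebra.antipode (R := k) (Sinv h) = h) (g : H) :
    counitHom k H (coactConv Sinv g) = g ⊗ₜ 1 := by
  have h₁ : convMap (counitHom k H) (convMap (fstHom k H) (opConv k H)) = 1 := by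
    ext g
    simp [convMap, counitHom, fstHom, opConv, opCounit_op, Algebra.algebraMap_eq_smul_one]
  have h₂ : convMap (counitHom k H)
      (convMap (fstHom k H) (opConvOf (HopfAlgebra.antipode k))) = 1 := by
    ext g
    simp [convMap, counitHom, fstHom, opConvOf, opCounit_op, Algebra.algebraMap_eq_smul_one]
  have h₃ : convMap (counitHom k H) (convMap (lastHom k H) (opConvOf Sinv)) *
      convMap (counitHom k H) (convMap (lastHom k H) (opConv k H)) = 1 := by
    rw [← convMap_mul, ← convMap_mul, opConvOf_antipodeInv_mul_opConv Sinv hSinv₁ hSinv₂,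
      convMap_one, convMap_one]
  rw [← convMap_apply, coactConv]
  simp only [convMap_mul, h₁, h₂, one_mul, mul_one]
  rw [← mul_assoc, h₃, one_mul]
  simp [convMap, counitHom, midHom]

end Coaction

/-! ### Evaluation of coefficients -/

section Evaluation

variable {P : Type} [AddCommGroup P] [Module k P]

/-- The map `v ⊗ w ↦ (v | w · p)`. -/
def evalPair (ρ : (H ⊗[k] P) →ₗ[k] P) (p : P) : (H ⊗[k] Hᵐᵒᵖ) →ₗ[k] (H ⊗[k] P) :=
  LinearMap.lTensor H (ρ ∘ₗ (TensorProduct.mk k H P).flip p ∘ₗ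
    (opLinearEquiv k : H ≃ₗ[k] Hᵐᵒᵖ).symm.toLinearMap)

/-- The map `u ⊗ (v ⊗ w) ↦ u ⊗ (v | w · p)`. -/
def evalCoeff (ρ : (H ⊗[k] P) →ₗ[k] P) (p : P) : Coeff k H →ₗ[k] H ⊗[k] (H ⊗[k] P) :=
  TensorProduct.map (opLinearEquiv k : H ≃ₗ[k] Hᵐᵒᵖ).symm.toLinearMap (evalPair ρ p)

/-- The map `(u₁ ⊗ u₂) ⊗ (v ⊗ w) ↦ (u₁ ⊗ u₂) ⊗ (v | w · p)`. -/
def evalCoeff₂ (ρ : (H ⊗[k] P) →ₗ[k] P) (p : P) :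
    Coeff₂ k H →ₗ[k] (H ⊗[k] H) ⊗[k] (H ⊗[k] P) :=
  TensorProduct.map (TensorProduct.map (opLinearEquiv k : H ≃ₗ[k] Hᵐᵒᵖ).symm.toLinearMap
    (opLinearEquiv k : H ≃ₗ[k] Hᵐᵒᵖ).symm.toLinearMap) (evalPair ρ p)

lemma rTensor_counit_evalCoeff (ρ : (H ⊗[k] P) →ₗ[k] P) (p : P) (x : Coeff k H) :
    TensorProduct.lid k (H ⊗[k] P) (LinearMap.rTensor (H ⊗[k] P) (Coalgebra.counit (R := k))
      (evalCoeff ρ p x)) = evalPair ρ p (counitHom k H x) := by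
  induction x using TensorProduct.induction_on with
  | zero => simp
  | add x y hx hy => simp only [map_add, hx, hy]
  | tmul u y =>
    induction u using MulOpposite.rec'
    simp [evalCoeff, counitHom, opCounit_op]

lemma rTensor_comul_evalCoeff (ρ : (H ⊗[k] P) →ₗ[k] P) (p : P) (x : Coeff k H) :
    LinearMap.rTensor (H ⊗[k] P) (Coalgebra.comul (R := k)) (evalCoeff ρ p x) =
      evalCoeff₂ ρ p (comulHom k H x) := by
  induction x using TensorProduct.induction_on with
  | zero => simp
  | add x y hx hy => simp only [map_add, hx, hy]
  | tmul u y =>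
    induction u using MulOpposite.rec' with | h u =>
    have (t : H ⊗[k] H) : TensorProduct.map
        (opLinearEquiv k : H ≃ₗ[k] Hᵐᵒᵖ).symm.toLinearMap
        (opLinearEquiv k : H ≃ₗ[k] Hᵐᵒᵖ).symm.toLinearMap
        (TensorProduct.map (opLinearEquiv k : H ≃ₗ[k] Hᵐᵒᵖ).toLinearMap
        (opLinearEquiv k : H ≃ₗ[k] Hᵐᵒᵖ).toLinearMap t) = t := by
      induction t with
      | zero => simp
      | add a b ha hb => simp only [map_add, ha, hb]
      | tmul a b => simp
    simp [evalCoeff, evalCoeff₂, comulHom, opComul_op, this]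

lemma evalCoeff₂_fstHom₂_mul (ρ : (H ⊗[k] P) →ₗ[k] P)
    (hρ : ∀ (g h : H) (p : P), ρ ((g * h) ⊗ₜ p) = ρ (g ⊗ₜ ρ (h ⊗ₜ p)))
    (p : P) (u w : H) (x : Coeff k H) :
    evalCoeff₂ ρ p (fstHom₂ k H (op u) * (inclHom k H (lastHom k H (op w)) * inclHom k H x)) =
      (TensorProduct.assoc k H H (H ⊗[k] P)).symm (u ⊗ₜ evalCoeff ρ (ρ (w ⊗ₜ p)) x) := by
  induction x using TensorProduct.induction_on with
  | zero => simp
  | add x y hx hy => simp only [map_add, mul_add, TensorProduct.tmul_add, hx, hy]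
  | tmul a y =>
    induction y with
    | zero => simp
    | add x y hx hy => simp only [map_add, mul_add, TensorProduct.tmul_add, hx, hy]
    | tmul b c =>
      simp [evalCoeff, evalCoeff₂, evalPair, fstHom₂, inclHom, lastHom, hρ]

end Evaluation

lemma bigDelta_tmul {C : Type} [AddCommGroup C] [Module k C] (Sinv : H →ₗ[k] H)
    (act : H →ₗ[k] C →ₗ[k] C) (n : ℕ) (g : H) (p : ↥(Pw k (ModuleCat.of k C) n)) :
    bigDelta Sinv act n (g ⊗ₜ p) =
      evalCoeff (dact (ModuleCat.of k C) (TensorProduct.lift act) n) p (coactConv Sinv g) := by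
  have (x : Coeff k H) : LinearMap.lTensor H (LinearMap.lTensor H
      (dact (ModuleCat.of k C) (TensorProduct.lift act) n))
      (LinearMap.lTensor H (TensorProduct.assoc k H H ↥(Pw k (ModuleCat.of k C) n)).toLinearMap
        (TensorProduct.assoc k H (H ⊗[k] H) ↥(Pw k (ModuleCat.of k C) n)
          (unopCoeff k H x ⊗ₜ p))) =
      evalCoeff (dact (ModuleCat.of k C) (TensorProduct.lift act) n) p x := by
    induction x using TensorProduct.induction_on with
    | zero => simp
    | add x y hx hy => simp only [map_add, TensorProduct.add_tmul, hx, hy]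
    | tmul a y =>
      induction y with
      | zero => simp
      | add x y hx hy => simp only [map_add, TensorProduct.add_tmul, TensorProduct.tmul_add, hx, hy]
      | tmul b c => simp [unopCoeff, evalCoeff, evalPair]
  rw [← this, ← wAux_delta4]
  rfl

end BigDelta

/-- The formula
`𝚫(g | a₀,…,aₙ) = (S(g⁽⁴⁾)g⁽¹⁾) ⊗ (g⁽³⁾ | (g⁽²⁾S⁻¹(g⁽⁰⁾)) · (a₀,…,aₙ))`
defines a left `H`-comodule structure on `H ⊗ C^{⊗(n+1)}`:
`(ε ⊗ id) ∘ 𝚫 = id` and `(Δ ⊗ id) ∘ 𝚫 = (id ⊗ 𝚫) ∘ 𝚫` (up to the associator). -/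
theorem bigDelta_comodule
    (Sinv : H →ₗ[k] H)
    (hSinv₁ : ∀ h : H, Sinv (HopfAlgebra.antipode (R := k) h) = h)
    (hSinv₂ : ∀ h : H, HopfAlgebra.antipode (R := k) (Sinv h) = h)
    (act : H →ₗ[k] C →ₗ[k] C)
    (hact_one : act 1 = LinearMap.id)
    (hact_mul : ∀ g h : H, act (g * h) = act g ∘ₗ act h)
    (hact_comul : (Coalgebra.comul (R := k)) ∘ₗ TensorProduct.lift act
      = (TensorProduct.map (TensorProduct.lift act) (TensorProduct.lift act))
          ∘ₗ (TensorProduct.tensorTensorTensorComm k H H C C).toLinearMap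
          ∘ₗ (TensorProduct.map (Coalgebra.comul (R := k)) (Coalgebra.comul (R := k))))
    (hact_counit : (Coalgebra.counit (R := k)) ∘ₗ TensorProduct.lift act
      = (TensorProduct.lid k k).toLinearMap
          ∘ₗ TensorProduct.map (Coalgebra.counit (R := k)) (Coalgebra.counit (R := k)))
    (n : ℕ) :
    (TensorProduct.lid k (H ⊗[k] ↥(Pw k (ModuleCat.of k C) n))).toLinearMap
        ∘ₗ (LinearMap.rTensor (H ⊗[k] ↥(Pw k (ModuleCat.of k C) n))
              (Coalgebra.counit (R := k)))
        ∘ₗ bigDelta Sinv act n = LinearMap.id ∧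
      (LinearMap.rTensor (H ⊗[k] ↥(Pw k (ModuleCat.of k C) n)) (Coalgebra.comul (R := k)))
          ∘ₗ bigDelta Sinv act n
        = (TensorProduct.assoc k H H
              (H ⊗[k] ↥(Pw k (ModuleCat.of k C) n))).symm.toLinearMap
            ∘ₗ (LinearMap.lTensor H (bigDelta Sinv act n))
            ∘ₗ bigDelta Sinv act n := by
  have hone : ∀ p : ↥(Pw k (ModuleCat.of k C) n),
      dact (ModuleCat.of k C) (TensorProduct.lift act) n ((1 : H) ⊗ₜ p) = p :=
    BigDelta.dact_one _ _ (fun m => by simp [hact_one]) n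
  have hmul : ∀ (g h : H) (p : ↥(Pw k (ModuleCat.of k C) n)),
      dact (ModuleCat.of k C) (TensorProduct.lift act) n ((g * h) ⊗ₜ p) =
        dact (ModuleCat.of k C) (TensorProduct.lift act) n
          (g ⊗ₜ dact (ModuleCat.of k C) (TensorProduct.lift act) n (h ⊗ₜ p)) :=
    BigDelta.dact_mul _ _ (fun g h m => by simp [hact_mul]) n
  constructor
  · refine TensorProduct.ext' fun g p => ?_
    simp only [LinearMap.comp_apply, LinearEquiv.coe_coe, LinearMap.id_apply]
    rw [BigDelta.bigDelta_tmul, BigDelta.rTensor_counit_evalCoeff,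
      BigDelta.counitHom_coactConv Sinv hSinv₁ hSinv₂]
    simp [BigDelta.evalPair, hone]
  · refine TensorProduct.ext' fun g p => ?_
    simp only [LinearMap.comp_apply, LinearEquiv.coe_coe]
    rw [BigDelta.bigDelta_tmul, BigDelta.rTensor_comul_evalCoeff,
      BigDelta.comulHom_coactConv Sinv hSinv₁ hSinv₂]
    generalize BigDelta.coactConv Sinv g = x
    induction x using TensorProduct.induction_on with
    | zero => simp
    | add x y hx hy => simp only [map_add, hx, hy]
    | tmul u y =>
      induction y with
      | zero => simp
      | add x y hx hy => simp only [map_add, TensorProduct.tmul_add, hx, hy]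
      | tmul v w =>
        induction u using MulOpposite.rec' with | h u =>
        induction w using MulOpposite.rec' with | h w =>
        rw [BigDelta.iterate_tmul, BigDelta.evalCoeff₂_fstHom₂_mul _ hmul]
        simp [BigDelta.evalCoeff, BigDelta.evalPair, BigDelta.bigDelta_tmul]

end
end

section
/- Let 𝔱 be the operator on H ⊗ C^{⊗(n+1)} defined by 𝔱(g | a_0, …, a_n) = (g^{(1)} | a_1, …, a_n, (g^{(0)} S(g^{(2)})) · a_0). Then 𝔱^{n+1} acts as the identity on the coinvariant space: for every x ∈ H ⊗ C^{⊗(n+1)} with 𝚫(x) = 1 ⊗ x, where 𝚫(g | a_0, …, a_n) = (S(g^{(4)}) g^{(1)}) ⊗ (g^{(3)} | (g^{(2)} S^{-1}(g^{(0)})) · (a_0, …, a_n)), one has 𝔱^{n+1}(x) = x. -/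
open TensorProduct Coalgebra

noncomputable section

variable {k : Type} [CommRing k]
variable {H : Type} [Ring H] [HopfAlgebra k H]

variable {C : Type} [AddCommGroup C] [Module k C] [Coalgebra k C]

/-- rotate: head to last: `(x₀,…,xₙ) ↦ (x₁,…,xₙ,x₀)`. -/
def rotOne (M : ModuleCat.{0} k) : ∀ n, ↥(Pw k M n) →ₗ[k] ↥(Pw k M n)
  | 0 => LinearMap.id
  | 1 => (TensorProduct.comm k ↥M ↥M).toLinearMap
  | n+2 => (LinearMap.lTensor ↥M (rotOne M (n+1)))
      ∘ₗ (TensorProduct.leftComm k ↥M ↥M ↥(Pw k M n)).toLinearMap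

/-- the sandwich decomposition `g ↦ (g⁽⁰⁾ S(g⁽²⁾)) ⊗ g⁽¹⁾`. -/
def sandw : H →ₗ[k] (H ⊗[k] H) :=
  (LinearMap.rTensor H (LinearMap.mul' k H))
    ∘ₗ (TensorProduct.assoc k H H H).symm.toLinearMap
    ∘ₗ (LinearMap.lTensor H
          ((TensorProduct.comm k H H).toLinearMap
            ∘ₗ LinearMap.lTensor H (HopfAlgebra.antipode (R := k))))
    ∘ₗ (LinearMap.lTensor H (Coalgebra.comul (R := k)))
    ∘ₗ (Coalgebra.comul (R := k))

/-- `rotL q : w ⊗ (a₀,…,a_q) ↦ (a₁,…,a_q, w · a₀)`. -/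
def rotL (act : H →ₗ[k] C →ₗ[k] C) :
    ∀ q, (H ⊗[k] ↥(Pw k (ModuleCat.of k C) q)) →ₗ[k] ↥(Pw k (ModuleCat.of k C) q)
  | 0 => TensorProduct.lift act
  | q+1 =>
      (rotOne (ModuleCat.of k C) (q+1))
        ∘ₗ (LinearMap.rTensor ↥(Pw k (ModuleCat.of k C) q) (TensorProduct.lift act))
        ∘ₗ (TensorProduct.assoc k H C ↥(Pw k (ModuleCat.of k C) q)).symm.toLinearMap

/-- the operator `𝔱(g | a₀,…,aₙ) = (g⁽¹⁾ | a₁,…,aₙ, (g⁽⁰⁾S(g⁽²⁾)) · a₀)`. -/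
def frakTC (act : H →ₗ[k] C →ₗ[k] C) (n : ℕ) :
    (H ⊗[k] ↥(Pw k (ModuleCat.of k C) n)) →ₗ[k]
      (H ⊗[k] ↥(Pw k (ModuleCat.of k C) n)) :=
  (LinearMap.lTensor H (rotL act n))
    ∘ₗ (TensorProduct.assoc k H H ↥(Pw k (ModuleCat.of k C) n)).toLinearMap
    ∘ₗ (LinearMap.rTensor ↥(Pw k (ModuleCat.of k C) n)
          ((TensorProduct.comm k H H).toLinearMap ∘ₗ (sandw : H →ₗ[k] H ⊗[k] H)))

section Convolution

open WithConv

variable {A B : Type} [Ring A] [Algebra k A] [Ring B] [Algebra k B]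

/-- An algebra map out of `H`, as an element of the convolution algebra. -/
def convOfAlgHom (f : H →ₐ[k] A) : WithConv (H →ₗ[k] A) := toConv f.toLinearMap

/-- The convolution inverse of `convOfAlgHom f`. -/
def convInvOfAlgHom (f : H →ₐ[k] A) : WithConv (H →ₗ[k] A) :=
  toConv (f.toLinearMap ∘ₗ HopfAlgebra.antipode k)

lemma algHom_comp_convOne (f : B →ₐ[k] A) :
    toConv (f.toLinearMap ∘ₗ (1 : WithConv (H →ₗ[k] B)).ofConv) = 1 := by
  ext h
  simp [LinearMap.convOne_def]

lemma algHom_comp_convMul (h : B →ₐ[k] A) (f g : WithConv (H →ₗ[k] B)) :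
    toConv (h.toLinearMap ∘ₗ (f * g).ofConv) =
      toConv (h.toLinearMap ∘ₗ f.ofConv) * toConv (h.toLinearMap ∘ₗ g.ofConv) := by
  rw [LinearMap.algHom_comp_convMul_distrib]

lemma convOfAlgHom_mul_inv (f : H →ₐ[k] A) : convOfAlgHom f * convInvOfAlgHom f = 1 := by
  have := algHom_comp_convMul f (toConv .id) (toConv (HopfAlgebra.antipode k (A := H)))
  rw [LinearMap.id_mul_antipode, algHom_comp_convOne] at this
  exact this.symm

lemma convInvOfAlgHom_mul (f : H →ₐ[k] A) : convInvOfAlgHom f * convOfAlgHom f = 1 := by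
  have := algHom_comp_convMul f (toConv (HopfAlgebra.antipode k (A := H))) (toConv .id)
  rw [LinearMap.antipode_mul_id, algHom_comp_convOne] at this
  exact this.symm

lemma convInvOfAlgHom_eq_of_mul {f : H →ₐ[k] A} {g h : H →ₐ[k] A}
    (hf : convOfAlgHom f = convOfAlgHom g * convOfAlgHom h) :
    convInvOfAlgHom f = convInvOfAlgHom h * convInvOfAlgHom g := by
  refine left_inv_eq_right_inv (convInvOfAlgHom_mul f) ?_
  rw [hf, mul_assoc, ← mul_assoc (convOfAlgHom h), convOfAlgHom_mul_inv, one_mul,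
    convOfAlgHom_mul_inv]

/-- `h ↦ h ⊗ 1`. -/
abbrev inclLeft : H →ₐ[k] H ⊗[k] A := Algebra.TensorProduct.includeLeft

/-- `h ↦ 1 ⊗ h`. -/
abbrev inclRight : A →ₐ[k] H ⊗[k] A := Algebra.TensorProduct.includeRight

variable (k H) in
lemma convOfAlgHom_comul :
    convOfAlgHom (Bialgebra.comulAlgHom k H) =
      convOfAlgHom inclLeft * convOfAlgHom inclRight := by
  ext h
  simp only [convOfAlgHom, LinearMap.convMul_apply]
  change comul h = _
  generalize (comul h : H ⊗[k] H) = s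
  induction s with
  | zero => simp
  | add x y hx hy => rw [map_add, map_add, ← hx, ← hy]
  | tmul x y => simp

variable (k H) in
lemma toConv_sandw :
    toConv (sandw : H →ₗ[k] H ⊗[k] H) =
      convOfAlgHom inclLeft * (convOfAlgHom inclRight * convInvOfAlgHom inclLeft) := by
  rw [convOfAlgHom, LinearMap.convMul_def, LinearMap.convMul_def]
  congr 1
  simp only [convOfAlgHom, convInvOfAlgHom, ofConv_toConv]
  have : (TensorProduct.map (inclLeft : H →ₐ[k] H ⊗[k] H).toLinearMap
      (LinearMap.mul' k (H ⊗[k] H) ∘ₗ TensorProduct.map (inclRight : H →ₐ[k] H ⊗[k] H).toLinearMap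
        ((inclLeft : H →ₐ[k] H ⊗[k] H).toLinearMap ∘ₗ HopfAlgebra.antipode k) ∘ₗ comul))
      = TensorProduct.map (inclLeft : H →ₐ[k] H ⊗[k] H).toLinearMap
      (LinearMap.mul' k (H ⊗[k] H) ∘ₗ TensorProduct.map (inclRight : H →ₐ[k] H ⊗[k] H).toLinearMap
        ((inclLeft : H →ₐ[k] H ⊗[k] H).toLinearMap ∘ₗ HopfAlgebra.antipode k)) ∘ₗ
          LinearMap.lTensor H comul := by
    ext; simp
  rw [this]
  unfold sandw
  simp only [← LinearMap.comp_assoc]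
  congr 2
  ext
  simp

/-- `sandw` is a left coaction of `H` on itself. -/
lemma sandw_coassoc (g : H) :
    TensorProduct.assoc k H H H (LinearMap.rTensor H comul (sandw (k := k) g)) =
      LinearMap.lTensor H (sandw (k := k)) (sandw (k := k) g) := by
  let j₁ : H →ₐ[k] H ⊗[k] (H ⊗[k] H) := inclLeft
  let j₂ : H →ₐ[k] H ⊗[k] (H ⊗[k] H) := inclRight.comp inclLeft
  let j₃ : H →ₐ[k] H ⊗[k] (H ⊗[k] H) := inclRight.comp inclRight
  let Δ : H ⊗[k] H →ₐ[k] H ⊗[k] (H ⊗[k] H) :=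
    (Algebra.TensorProduct.assoc k k k H H H).toAlgHom.comp
      (Algebra.TensorProduct.map (Bialgebra.comulAlgHom k H) (AlgHom.id k H))
  let α : H ⊗[k] H →ₐ[k] H ⊗[k] (H ⊗[k] H) :=
    (Algebra.TensorProduct.assoc k k k H H H).toAlgHom.comp inclLeft
  have hΔ : convOfAlgHom (Δ.comp inclLeft) = convOfAlgHom j₁ * convOfAlgHom j₂ := by
    have h1 : Δ.comp inclLeft = α.comp (Bialgebra.comulAlgHom k H) := by
      ext; simp [Δ, α]
    have h2 : convOfAlgHom (α.comp (Bialgebra.comulAlgHom k H))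
        = toConv (α.toLinearMap ∘ₗ (convOfAlgHom (Bialgebra.comulAlgHom k H)).ofConv) := rfl
    rw [h1, h2, convOfAlgHom_comul, algHom_comp_convMul]
    congr 1
  have h₁ : toConv (Δ.toLinearMap ∘ₗ (sandw : H →ₗ[k] H ⊗[k] H)) =
      convOfAlgHom j₁ * convOfAlgHom j₂ * (convOfAlgHom j₃ *
        (convInvOfAlgHom j₂ * convInvOfAlgHom j₁)) := by
    rw [← convInvOfAlgHom_eq_of_mul hΔ, ← hΔ]
    have := algHom_comp_convMul Δ (convOfAlgHom (inclLeft : H →ₐ[k] H ⊗[k] H))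
      (convOfAlgHom inclRight * convInvOfAlgHom inclLeft)
    rw [← toConv_sandw, algHom_comp_convMul] at this
    rw [← ofConv_toConv sandw, this]
    congr 2
    ext h
    simp [convOfAlgHom, Δ, j₃, Algebra.TensorProduct.one_def]
  have h₂ : toConv (LinearMap.lTensor H (sandw (k := k)) ∘ₗ (sandw : H →ₗ[k] H ⊗[k] H)) =
      convOfAlgHom j₁ * (convOfAlgHom j₂ * (convOfAlgHom j₃ * convInvOfAlgHom j₂) *
        convInvOfAlgHom j₁) := by
    have h3 : convOfAlgHom j₂ * (convOfAlgHom j₃ * convInvOfAlgHom j₂) =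
        toConv ((inclRight (k := k) (H := H) (A := H ⊗[k] H)).toLinearMap ∘ₗ sandw) := by
      rw [← ofConv_toConv sandw, toConv_sandw, algHom_comp_convMul, algHom_comp_convMul]
      congr 1
    rw [h3]
    have h4 : LinearMap.lTensor H (sandw (k := k)) ∘ₗ (sandw : H →ₗ[k] H ⊗[k] H) =
      LinearMap.lTensor H (sandw (k := k)) ∘ₗ (toConv (sandw : H →ₗ[k] H ⊗[k] H)).ofConv := rfl
    rw [h4, toConv_sandw, LinearMap.convMul_def, LinearMap.convMul_def, LinearMap.convMul_def,
      LinearMap.convMul_def]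
    congr 1
    ext g
    simp only [LinearMap.comp_apply]
    generalize (comul g : H ⊗[k] H) = s
    induction s with
    | zero => simp
    | add x y hx hy => simp only [map_add, hx, hy]
    | tmul x y =>
      simp only [map_tmul, LinearMap.comp_apply]
      generalize (comul y : H ⊗[k] H) = t
      induction t with
      | zero => simp
      | add x y hx hy => simp only [map_add, tmul_add, hx, hy]
      | tmul y z => simp [convOfAlgHom, convInvOfAlgHom, j₁]
  have h₃ : toConv (Δ.toLinearMap ∘ₗ (sandw : H →ₗ[k] H ⊗[k] H)) =
      toConv (LinearMap.lTensor H (sandw (k := k)) ∘ₗ (sandw : H →ₗ[k] H ⊗[k] H)) := by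
    rw [h₁, h₂]; simp only [mul_assoc]
  exact congrArg (fun f => f.ofConv g) h₃

/-- `∑ g⁽⁰⁾S(g⁽²⁾)g⁽³⁾ ⊗ g⁽¹⁾ = Δ g`. -/
lemma sandw_convMul_inclLeft :
    toConv (sandw : H →ₗ[k] H ⊗[k] H) * convOfAlgHom inclLeft =
      convOfAlgHom (Bialgebra.comulAlgHom k H) := by
  rw [toConv_sandw, mul_assoc, mul_assoc, convInvOfAlgHom_mul, mul_one, convOfAlgHom_comul]

end Convolution

section Coinvariance

/-- `h ⊗ (g ⊗ w) ↦ ∑ v ⊗ u w`, where `sandw (g h) = ∑ u ⊗ v`. -/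
def sandwMul : H ⊗[k] (H ⊗[k] H) →ₗ[k] H ⊗[k] H :=
  (TensorProduct.comm k H H).toLinearMap ∘ₗ LinearMap.mul' k (H ⊗[k] H) ∘ₗ
    TensorProduct.map (sandw ∘ₗ LinearMap.mul' k H ∘ₗ (TensorProduct.comm k H H).toLinearMap)
      (inclLeft : H →ₐ[k] H ⊗[k] H).toLinearMap ∘ₗ
    (TensorProduct.assoc k H H H).symm.toLinearMap

lemma sandwMul_tmul (h g w : H) :
    sandwMul (k := k) (h ⊗ₜ (g ⊗ₜ w)) =
      TensorProduct.comm k H H (sandw (k := k) (g * h) * (w ⊗ₜ[k] (1 : H))) := by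
  simp [sandwMul]

lemma wAux_tmul (Sinv : H →ₗ[k] H) (x y z s r : H) :
    wAux Sinv (x ⊗ₜ (y ⊗ₜ (z ⊗ₜ (s ⊗ₜ r)))) =
      (HopfAlgebra.antipode k r * y) ⊗ₜ (s ⊗ₜ (z * Sinv x)) := by
  simp [wAux]

/-- `∑ g⁽⁰⁾ ⊗ g⁽¹⁾S(g⁽²⁾) = g ⊗ 1`. -/
lemma lTensor_mul_antipode_comul₂ (g : H) :
    LinearMap.lTensor H (LinearMap.mul' k H ∘ₗ
      LinearMap.lTensor H (HopfAlgebra.antipode k))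
        (LinearMap.lTensor H comul (comul g)) = g ⊗ₜ[k] (1 : H) := by
  have h1 : LinearMap.lTensor H (LinearMap.mul' k H ∘ₗ
      LinearMap.lTensor H (HopfAlgebra.antipode k)) ∘ₗ LinearMap.lTensor H comul =
      LinearMap.lTensor H (Algebra.linearMap k H) ∘ₗ LinearMap.lTensor H (counit (R := k)) := by
    rw [← LinearMap.lTensor_comp, ← LinearMap.lTensor_comp, LinearMap.comp_assoc,
      HopfAlgebra.mul_antipode_lTensor_comul]
  have h2 := LinearMap.congr_fun h1 (comul g)
  simp only [LinearMap.comp_apply] at h2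
  rw [h2, Coalgebra.lTensor_counit_comul]
  simp

lemma delta4_apply (g : H) :
    delta4 (k := k) g = LinearMap.lTensor H (LinearMap.lTensor H
      (LinearMap.lTensor H comul ∘ₗ comul)) (LinearMap.lTensor H comul (comul g)) := by
  simp [delta4, LinearMap.lTensor_comp]

/-- `∑ g⁽¹⁾S⁻¹(g⁽⁰⁾) = ε(g)`. -/
lemma mul_antipodeInv_comm_comul {Sinv : H →ₗ[k] H}
    (hSinv₁ : ∀ h : H, Sinv (HopfAlgebra.antipode (R := k) h) = h)
    (hSinv₂ : ∀ h : H, HopfAlgebra.antipode (R := k) (Sinv h) = h) (g : H) :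
    LinearMap.mul' k H (TensorProduct.comm k H H (LinearMap.rTensor H Sinv (comul g))) =
      algebraMap k H (counit g) := by
  apply Function.LeftInverse.injective hSinv₁
  have h1 : HopfAlgebra.antipode k ∘ₗ LinearMap.mul' k H ∘ₗ
      (TensorProduct.comm k H H).toLinearMap ∘ₗ LinearMap.rTensor H Sinv =
      LinearMap.mul' k H ∘ₗ LinearMap.lTensor H (HopfAlgebra.antipode k) := by
    ext x y
    simp [HopfAlgebra.antipode_mul_antidistrib, hSinv₂]
  refine (LinearMap.congr_fun h1 (comul g)).trans ?_
  simp only [LinearMap.comp_apply, HopfAlgebra.mul_antipode_lTensor_comul_apply]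
  rw [Algebra.algebraMap_eq_smul_one, map_smul, HopfAlgebra.antipode_one]

/-- `∑ sandw(g⁽⁰⁾) (g⁽¹⁾ ⊗ 1) = Δ g`. -/
lemma mul_sandw_inclLeft_comul (g : H) :
    LinearMap.mul' k (H ⊗[k] H) (TensorProduct.map sandw
      (inclLeft : H →ₐ[k] H ⊗[k] H).toLinearMap (comul g)) = comul g :=
  congrArg (fun f => f.ofConv g) (sandw_convMul_inclLeft (k := k) (H := H))

lemma sandwMul_wAux_delta4 {Sinv : H →ₗ[k] H}
    (hSinv₁ : ∀ h : H, Sinv (HopfAlgebra.antipode (R := k) h) = h)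
    (hSinv₂ : ∀ h : H, HopfAlgebra.antipode (R := k) (Sinv h) = h) (g : H) :
    sandwMul (wAux Sinv (delta4 (k := k) g)) = g ⊗ₜ[k] (1 : H) := by
  let c := (TensorProduct.comm k H H).toLinearMap
  let ι : H →ₗ[k] H ⊗[k] H := (inclLeft : H →ₐ[k] H ⊗[k] H).toLinearMap
  -- `x ⊗ (y ⊗ (z ⊗ a)) ↦ comm (sandw (a y) (z S⁻¹(x) ⊗ 1))`
  let Q : H ⊗[k] (H ⊗[k] (H ⊗[k] H)) →ₗ[k] H ⊗[k] H :=
    TensorProduct.lift (LinearMap.llcomp k _ _ _ c ∘ₗ (LinearMap.lcomp k _ (LinearMap.mul' k _ ∘ₗ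
      TensorProduct.map (sandw ∘ₗ LinearMap.mul' k H ∘ₗ c) ι ∘ₗ
      (TensorProduct.assoc k H H H).symm.toLinearMap ∘ₗ LinearMap.lTensor H c)) ∘ₗ
      (LinearMap.mul k (H ⊗[k] H)).flip ∘ₗ ι ∘ₗ Sinv)
  have hQ (x y z a : H) : Q (x ⊗ₜ (y ⊗ₜ (z ⊗ₜ a))) =
      c (sandw (k := k) (a * y) * ((z * Sinv x) ⊗ₜ[k] (1 : H))) := by
    simp [Q, c, ι, mul_assoc]
  have h1 : sandwMul ∘ₗ wAux Sinv = Q ∘ₗ LinearMap.lTensor H (LinearMap.lTensor H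
      (LinearMap.lTensor H (LinearMap.mul' k H ∘ₗ
        LinearMap.lTensor H (HopfAlgebra.antipode k)))) := by
    ext x y z s r
    simp [wAux_tmul, sandwMul_tmul, hQ, c, mul_assoc]
  have h2 : LinearMap.lTensor H (LinearMap.lTensor H
      (LinearMap.lTensor H (LinearMap.mul' k H ∘ₗ
        LinearMap.lTensor H (HopfAlgebra.antipode k)))) ∘ₗ
      LinearMap.lTensor H (LinearMap.lTensor H (LinearMap.lTensor H comul ∘ₗ comul)) =
      LinearMap.lTensor H (LinearMap.lTensor H ι) := by
    rw [← LinearMap.lTensor_comp, ← LinearMap.lTensor_comp]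
    congr 2
    ext g
    simpa [ι] using lTensor_mul_antipode_comul₂ (k := k) g
  let Q₃ : H ⊗[k] (H ⊗[k] H) →ₗ[k] H ⊗[k] H :=
    c ∘ₗ TensorProduct.lift ((LinearMap.mul k (H ⊗[k] H)).flip ∘ₗ ι ∘ₗ Sinv)
  have h3 : Q ∘ₗ LinearMap.lTensor H (LinearMap.lTensor H ι) ∘ₗ LinearMap.lTensor H comul =
      Q₃ ∘ₗ LinearMap.lTensor H comul := by
    have : Q ∘ₗ LinearMap.lTensor H (LinearMap.lTensor H ι) = Q₃ ∘ₗ LinearMap.lTensor H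
        (LinearMap.mul' k (H ⊗[k] H) ∘ₗ TensorProduct.map sandw ι) := by
      ext x y z
      simp [hQ, Q₃, ι, c, mul_assoc]
    rw [← LinearMap.comp_assoc, this, LinearMap.comp_assoc, ← LinearMap.lTensor_comp]
    congr 2
    ext g
    exact mul_sandw_inclLeft_comul (k := k) g
  have h4 : Q₃ ∘ₗ (TensorProduct.assoc k H H H).toLinearMap =
      c ∘ₗ LinearMap.rTensor H (LinearMap.mul' k H ∘ₗ c ∘ₗ LinearMap.rTensor H Sinv) := by
    ext x y z
    simp [Q₃, ι, c]
  have h5 : (LinearMap.mul' k H ∘ₗ c ∘ₗ LinearMap.rTensor H Sinv) ∘ₗ comul =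
      Algebra.linearMap k H ∘ₗ counit := by
    ext g
    exact mul_antipodeInv_comm_comul hSinv₁ hSinv₂ g
  calc sandwMul (wAux Sinv (delta4 (k := k) g))
      = Q (LinearMap.lTensor H (LinearMap.lTensor H ι) (LinearMap.lTensor H comul (comul g))) := by
        rw [delta4_apply, ← LinearMap.comp_apply, h1, LinearMap.comp_apply]
        exact congrArg Q (LinearMap.congr_fun h2 _)
    _ = Q₃ (LinearMap.lTensor H comul (comul g)) := LinearMap.congr_fun h3 (comul g)
    _ = c (LinearMap.rTensor H (LinearMap.mul' k H ∘ₗ c ∘ₗ LinearMap.rTensor H Sinv)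
          (LinearMap.rTensor H comul (comul g))) := by
        rw [← Coalgebra.coassoc_apply]
        exact LinearMap.congr_fun h4 _
    _ = c (LinearMap.rTensor H (Algebra.linearMap k H ∘ₗ counit) (comul g)) := by
        rw [← LinearMap.comp_apply (LinearMap.rTensor H _), ← LinearMap.rTensor_comp, h5]
    _ = g ⊗ₜ[k] (1 : H) := by
        rw [LinearMap.rTensor_comp, LinearMap.comp_apply, Coalgebra.rTensor_counit_comul]
        simp [c]

end Coinvariance

section SandwichOperators

variable {P : Type} [AddCommGroup P] [Module k P]

/-- `g ⊗ p ↦ ∑ g⁽¹⁾ ⊗ G(g⁽⁰⁾S(g⁽²⁾) ⊗ p)`. -/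
def sandwOp (G : H ⊗[k] P →ₗ[k] P) : H ⊗[k] P →ₗ[k] H ⊗[k] P :=
  LinearMap.lTensor H G ∘ₗ (TensorProduct.assoc k H H P).toLinearMap ∘ₗ
    LinearMap.rTensor P ((TensorProduct.comm k H H).toLinearMap ∘ₗ sandw)

lemma sandwOp_tmul (G : H ⊗[k] P →ₗ[k] P) (g : H) (p : P) :
    sandwOp G (g ⊗ₜ p) = LinearMap.lTensor H (G ∘ₗ (TensorProduct.mk k H P).flip p)
      (TensorProduct.comm k H H (sandw g)) := by
  simp only [sandwOp, LinearMap.comp_apply, LinearMap.rTensor_tmul, LinearEquiv.coe_coe]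
  generalize TensorProduct.comm k H H (sandw g) = s
  induction s with
  | zero => simp
  | add x y hx hy => rw [add_tmul]; simp only [map_add, hx, hy]
  | tmul x y => simp

lemma sandwOp_comp_left (r : P →ₗ[k] P) (G : H ⊗[k] P →ₗ[k] P) :
    sandwOp (r ∘ₗ G) = LinearMap.lTensor H r ∘ₗ sandwOp G := by
  simp only [sandwOp, LinearMap.lTensor_comp, LinearMap.comp_assoc]

lemma sandwOp_comp_lTensor (G : H ⊗[k] P →ₗ[k] P) (r : P →ₗ[k] P) :
    sandwOp G ∘ₗ LinearMap.lTensor H r = sandwOp (G ∘ₗ LinearMap.lTensor H r) := by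
  ext g p
  simp only [AlgebraTensorModule.curry_apply, LinearMap.restrictScalars_self, curry_apply,
    LinearMap.comp_apply, LinearMap.lTensor_tmul, sandwOp_tmul]
  congr 2

/-- `w ↦ ∑ F(w⁽¹⁾) G(w⁽⁰⁾)`. -/
def revConv {A : Type} [Ring A] [Algebra k A] (F G : H →ₗ[k] A) : H →ₗ[k] A :=
  LinearMap.mul' k A ∘ₗ TensorProduct.map F G ∘ₗ (TensorProduct.comm k H H).toLinearMap ∘ₗ comul

lemma sandwOp_lift_comp (F G : H →ₗ[k] Module.End k P) :
    sandwOp (TensorProduct.lift F) ∘ₗ sandwOp (TensorProduct.lift G) =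
      sandwOp (TensorProduct.lift (revConv F G)) := by
  ext g p
  simp only [AlgebraTensorModule.curry_apply, LinearMap.restrictScalars_self, curry_apply,
    LinearMap.comp_apply, sandwOp_tmul]
  -- `u ⊗ (u' ⊗ v) ↦ v ⊗ F(u') (G(u) p)`
  let Ω : H ⊗[k] (H ⊗[k] H) →ₗ[k] H ⊗[k] P :=
    (TensorProduct.comm k P H).toLinearMap ∘ₗ
      LinearMap.rTensor H (TensorProduct.lift F ∘ₗ LinearMap.lTensor H (G.flip p) ∘ₗ
        (TensorProduct.comm k H H).toLinearMap) ∘ₗ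
      (TensorProduct.assoc k H H H).symm.toLinearMap
  have hΩ (u u' v : H) : Ω (u ⊗ₜ (u' ⊗ₜ v)) = v ⊗ₜ F u' (G u p) := by simp [Ω]
  have h1 (s : H ⊗[k] H) : sandwOp (TensorProduct.lift F) (LinearMap.lTensor H
      (TensorProduct.lift G ∘ₗ (TensorProduct.mk k H P).flip p) (TensorProduct.comm k H H s)) =
      Ω (LinearMap.lTensor H (sandw (k := k)) s) := by
    induction s with
    | zero => simp
    | add x y hx hy => simp only [map_add, hx, hy]
    | tmul u v =>
      simp only [comm_tmul, LinearMap.lTensor_tmul, LinearMap.comp_apply, sandwOp_tmul]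
      generalize (sandw v : H ⊗[k] H) = t
      induction t with
      | zero => simp
      | add x y hx hy => simp only [map_add, tmul_add, hx, hy]
      | tmul u' v => simp [hΩ]
  have h2 (s : H ⊗[k] H) : LinearMap.lTensor H
      (TensorProduct.lift (revConv F G) ∘ₗ (TensorProduct.mk k H P).flip p)
        (TensorProduct.comm k H H s) =
      Ω (TensorProduct.assoc k H H H (LinearMap.rTensor H comul s)) := by
    induction s with
    | zero => simp
    | add x y hx hy => simp only [map_add, hx, hy]
    | tmul u v =>
      simp only [comm_tmul, LinearMap.lTensor_tmul, LinearMap.rTensor_tmul, LinearMap.comp_apply,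
        revConv, LinearMap.flip_apply, TensorProduct.mk_apply, TensorProduct.lift.tmul,
        LinearEquiv.coe_coe]
      generalize (comul u : H ⊗[k] H) = t
      induction t with
      | zero => simp
      | add x y hx hy => simp only [map_add, tmul_add, add_tmul, LinearMap.add_apply, hx, hy]
      | tmul u' v => simp [hΩ]
  rw [h1, h2, sandw_coassoc]

end SandwichOperators

section TensorPower

variable {V : Type} [AddCommGroup V] [Module k V]

variable (k V) in
/-- `V^{⊗(n+1)}`. -/
abbrev TPow (n : ℕ) : Type := ↥(Pw k (ModuleCat.of k V) n)

/-- `a₀ ⊗ ⋯ ⊗ aₙ`. -/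
def pureTensor : ∀ n, (ℕ → V) → TPow k V n
  | 0, a => a 0
  | n + 1, a => (a 0 ⊗ₜ[k] (pureTensor n fun i => a (i + 1)) : V ⊗[k] TPow k V n)

lemma pureTensor_congr : ∀ (n : ℕ) {a b : ℕ → V}, (∀ i ≤ n, a i = b i) →
    (pureTensor n a : TPow k V n) = pureTensor n b
  | 0, _, _, h => h 0 le_rfl
  | n + 1, a, b, h => by
    change (a 0 ⊗ₜ[k] _ : V ⊗[k] TPow k V n) = b 0 ⊗ₜ[k] _
    rw [h 0 (Nat.zero_le _), pureTensor_congr n fun i hi => h (i + 1) (by omega)]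

lemma ext_pureTensor {N : Type} [AddCommGroup N] [Module k N] :
    ∀ (n : ℕ) {f g : TPow k V n →ₗ[k] N},
      (∀ a, f (pureTensor n a) = g (pureTensor n a)) → f = g
  | 0, _, _, h => LinearMap.ext fun c => h fun _ => c
  | n + 1, f, g, h => by
    refine TensorProduct.ext (M := V) (N := TPow k V n) (LinearMap.ext fun c => ?_)
    refine ext_pureTensor n fun a => ?_
    exact h fun i => Nat.casesOn i c a

lemma rotOne_pureTensor : ∀ (n : ℕ) {a b : ℕ → V}, (∀ i < n, b i = a (i + 1)) → b n = a 0 →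
    rotOne (ModuleCat.of k V) n (pureTensor n a) = pureTensor n b
  | 0, _, _, _, h => h.symm
  | 1, a, b, h, h' => by
    change (a 1 ⊗ₜ[k] a 0 : V ⊗[k] V) = b 0 ⊗ₜ[k] b 1
    rw [h 0 one_pos, h']
  | n + 2, a, b, h, h' => by
    change (a 1 ⊗ₜ[k] rotOne (ModuleCat.of k V) (n + 1)
        (pureTensor (n + 1) fun i => Nat.casesOn i (a 0) fun j => a (j + 2)) :
          V ⊗[k] TPow k V (n + 1)) = b 0 ⊗ₜ[k] pureTensor (n + 1) fun i => b (i + 1)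
    rw [h 0 (by omega), rotOne_pureTensor (n + 1) (fun i hi => h (i + 1) (by omega)) h']

lemma rotOne_pow_pureTensor (n : ℕ) {a : ℕ → V} (ha : ∀ i, a (i + (n + 1)) = a i) (j : ℕ) :
    (rotOne (ModuleCat.of k V) n ^ j) (pureTensor n a) = pureTensor n fun i => a (i + j) := by
  induction j with
  | zero => rfl
  | succ j ih =>
    rw [pow_succ', Module.End.mul_apply, ih]
    refine rotOne_pureTensor n (fun i _ => ?_) ?_
    · exact congrArg a (by omega)
    · rw [← ha (0 + j)]
      exact congrArg a (by omega)

lemma rotOne_pow_succ_self (n : ℕ) : rotOne (ModuleCat.of k V) n ^ (n + 1) = 1 := by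
  refine ext_pureTensor n fun a => ?_
  have h : (pureTensor n a : TPow k V n) = pureTensor n fun i => a (i % (n + 1)) :=
    pureTensor_congr n fun i hi => by rw [Nat.mod_eq_of_lt (by omega)]
  rw [h, rotOne_pow_pureTensor n (fun i => by simp)]
  exact pureTensor_congr n fun i _ => by simp

variable (k V) in
/-- An endomorphism of `V` acting on the tensor factor with index `j`. -/
def slotMap : ∀ n, ℕ → Module.End k V →ₗ[k] Module.End k (TPow k V n)
  | 0, _ => .id
  | n + 1, 0 => LinearMap.rTensorHom (TPow k V n)
  | n + 1, j + 1 => LinearMap.lTensorHom (R := k) V ∘ₗ slotMap n j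

lemma slotMap_comp_rotOne : ∀ (n : ℕ) {j : ℕ}, j < n → ∀ f : Module.End k V,
    slotMap k V n j f ∘ₗ rotOne (ModuleCat.of k V) n =
      rotOne (ModuleCat.of k V) n ∘ₗ slotMap k V n (j + 1) f
  | 1, 0, _, _ => ext_pureTensor 1 fun _ => rfl
  | n + 2, 0, _, _ => ext_pureTensor (n + 2) fun _ => rfl
  | n + 2, _ + 1, hj, f => ext_pureTensor (n + 2) fun a =>
    congrArg (fun q => (a 1 ⊗ₜ[k] q : V ⊗[k] TPow k V (n + 1)))
      (LinearMap.congr_fun (slotMap_comp_rotOne (n + 1) (Nat.lt_of_succ_lt_succ hj) f)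
        (a 0 ⊗ₜ[k] pureTensor n fun i => a (i + 2) : V ⊗[k] TPow k V n))

lemma slotMap_zero_comp_rotOne_pow (n : ℕ) {j : ℕ} (hj : j ≤ n) (f : Module.End k V) :
    slotMap k V n 0 f ∘ₗ (rotOne (ModuleCat.of k V) n ^ j) =
      (rotOne (ModuleCat.of k V) n ^ j) ∘ₗ slotMap k V n j f := by
  induction j with
  | zero => rfl
  | succ j ih =>
    rw [pow_succ, Module.End.mul_eq_comp, ← LinearMap.comp_assoc, ih (by omega),
      LinearMap.comp_assoc, slotMap_comp_rotOne n (by omega), LinearMap.comp_assoc]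

/-- The diagonal action of `H` on the first `j` factors of `V^{⊗(n+1)}`. -/
def partialAct (ρ : H →ₐ[k] Module.End k V) : ∀ n, ℕ → (H →ₐ[k] Module.End k (TPow k V n))
  | _, 0 => (Algebra.ofId k _).comp (Bialgebra.counitAlgHom k H)
  | 0, _ + 1 => ρ
  | n + 1, j + 1 =>
    (Module.endTensorEndAlgHom (R := k) (S := k) (A := k) (M := V) (N := TPow k V n)).comp
      ((Algebra.TensorProduct.map ρ (partialAct ρ n j)).comp (Bialgebra.comulAlgHom k H))

lemma partialAct_zero (ρ : H →ₐ[k] Module.End k V) : ∀ n,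
    partialAct ρ n 0 = (Algebra.ofId k _).comp (Bialgebra.counitAlgHom k H)
  | 0 => rfl
  | _ + 1 => rfl

lemma revConv_counit {A : Type} [Ring A] [Algebra k A] (F : H →ₗ[k] A) :
    revConv F ((Algebra.ofId k A).comp (Bialgebra.counitAlgHom k H)).toLinearMap = F := by
  ext w
  have h : LinearMap.mul' k A ∘ₗ TensorProduct.map F
      ((Algebra.ofId k A).comp (Bialgebra.counitAlgHom k H)).toLinearMap ∘ₗ
        (TensorProduct.comm k H H).toLinearMap =
      F ∘ₗ (TensorProduct.lid k H).toLinearMap ∘ₗ LinearMap.rTensor H counit := by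
    ext x y
    simp [Algebra.ofId_apply, Algebra.algebraMap_eq_smul_one]
  refine (LinearMap.congr_fun h (comul w)).trans ?_
  simp

lemma partialAct_succ (ρ : H →ₐ[k] Module.End k V) : ∀ (n : ℕ) {j : ℕ}, j ≤ n →
    (partialAct ρ n (j + 1)).toLinearMap =
      revConv (slotMap k V n j ∘ₗ ρ.toLinearMap) (partialAct ρ n j).toLinearMap
  | 0, 0, _ => (revConv_counit ρ.toLinearMap).symm
  | n + 1, 0, _ => by
    refine Eq.trans ?_ (revConv_counit _).symm
    ext w : 1
    have h : (Module.endTensorEndAlgHom (R := k) (S := k) (A := k) (M := V)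
        (N := TPow k V n)).toLinearMap ∘ₗ
        TensorProduct.map ρ.toLinearMap (partialAct ρ n 0).toLinearMap =
        LinearMap.rTensorHom (TPow k V n) ∘ₗ ρ.toLinearMap ∘ₗ
          (TensorProduct.rid k H).toLinearMap ∘ₗ LinearMap.lTensor H counit := by
      ext x y : 3
      simp [partialAct, Algebra.ofId_apply, Algebra.algebraMap_eq_smul_one, LinearMap.rTensor,
        TensorProduct.map_smul_left]
      rfl
    refine (LinearMap.congr_fun h (comul w)).trans ?_
    simp [slotMap]
    rfl
  | n + 1, j + 1, hj => by
    ext w : 1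
    let E := (Module.endTensorEndAlgHom (R := k) (S := k) (A := k) (M := V)
      (N := TPow k V n)).toLinearMap
    let σ := slotMap k V n j ∘ₗ ρ.toLinearMap
    let D := (partialAct ρ n j).toLinearMap
    let μ := LinearMap.mul' k (Module.End k (TPow k V n)) ∘ₗ TensorProduct.map σ D ∘ₗ
      (TensorProduct.comm k H H).toLinearMap
    have h1 : (partialAct ρ (n + 1) (j + 2)).toLinearMap w =
        (E ∘ₗ TensorProduct.map ρ.toLinearMap μ) (LinearMap.lTensor H comul (comul w)) := by
      change E (TensorProduct.map ρ.toLinearMap (partialAct ρ n (j + 1)).toLinearMap (comul w)) = _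
      rw [partialAct_succ ρ n (Nat.le_of_succ_le_succ hj), LinearMap.comp_apply,
        ← LinearMap.comp_apply _ (LinearMap.lTensor H comul), LinearMap.map_comp_lTensor]
      rfl
    have h2 : revConv (slotMap k V (n + 1) (j + 1) ∘ₗ ρ.toLinearMap)
        (partialAct ρ (n + 1) (j + 1)).toLinearMap w =
        (LinearMap.mul' k (Module.End k (V ⊗[k] TPow k V n)) ∘ₗ
          TensorProduct.map (LinearMap.lTensorHom (R := k) V ∘ₗ σ)
            (E ∘ₗ TensorProduct.map ρ.toLinearMap D) ∘ₗ
              (TensorProduct.comm k (H ⊗[k] H) H).toLinearMap)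
          (LinearMap.rTensor H comul (comul w)) := by
      change LinearMap.mul' k (Module.End k (V ⊗[k] TPow k V n)) (TensorProduct.map _ _
        (TensorProduct.comm k H H (comul w))) = _
      generalize (comul w : H ⊗[k] H) = s
      induction s with
      | zero => simp
      | add x y hx hy => simp only [map_add, hx, hy]
      | tmul x y => rfl
    have h3 : (LinearMap.mul' k (Module.End k (V ⊗[k] TPow k V n)) ∘ₗ
          TensorProduct.map (LinearMap.lTensorHom (R := k) V ∘ₗ σ)
            (E ∘ₗ TensorProduct.map ρ.toLinearMap D) ∘ₗ
              (TensorProduct.comm k (H ⊗[k] H) H).toLinearMap) =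
        (E ∘ₗ TensorProduct.map ρ.toLinearMap μ) ∘ₗ
          (TensorProduct.assoc k H H H).toLinearMap := by
      ext x y z : 6
      refine LinearMap.ext fun c => LinearMap.ext fun p => ?_
      rfl
    rw [h1, h2, h3, ← Coalgebra.coassoc_apply]
    rfl

lemma lift_partialAct_eq_dact (ρ : H →ₐ[k] Module.End k V) : ∀ n,
    TensorProduct.lift (partialAct ρ n (n + 1)).toLinearMap =
      dact (ModuleCat.of k V) (TensorProduct.lift ρ.toLinearMap) n
  | 0 => rfl
  | n + 1 => by
    refine TensorProduct.ext' (M := H) (N := V ⊗[k] TPow k V n) fun w cp => ?_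
    have h : dact (ModuleCat.of k V) (TensorProduct.lift ρ.toLinearMap) (n + 1) =
      (TensorProduct.map (TensorProduct.lift ρ.toLinearMap)
        (TensorProduct.lift (partialAct ρ n (n + 1)).toLinearMap))
        ∘ₗ (TensorProduct.tensorTensorTensorComm k H H V (TPow k V n)).toLinearMap
        ∘ₗ (LinearMap.rTensor (V ⊗[k] TPow k V n) (Coalgebra.comul (R := k))) := by
      rw [lift_partialAct_eq_dact ρ n]; rfl
    rw [h]
    change TensorProduct.homTensorHomMap (RingHom.id k) V (TPow k V n) V (TPow k V n)
      (TensorProduct.map ρ.toLinearMap (partialAct ρ n (n + 1)).toLinearMap (comul w)) cp =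
        TensorProduct.map _ _ (TensorProduct.tensorTensorTensorComm k H H V (TPow k V n)
          (comul w ⊗ₜ[k] cp))
    generalize (comul w : H ⊗[k] H) = s
    induction s with
    | zero => simp
    | add x y hx hy => simp only [map_add, LinearMap.add_apply, add_tmul, hx, hy]
    | tmul x y =>
      induction cp using TensorProduct.induction_on with
      | zero => simp
      | add x y hx hy => simp only [map_add, tmul_add, hx, hy]
      | tmul c p => rfl

end TensorPower

section Iterate

variable {V : Type} [AddCommGroup V] [Module k V]

lemma rotL_eq (act : H →ₗ[k] V →ₗ[k] V) : ∀ n, rotL act n =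
    rotOne (ModuleCat.of k V) n ∘ₗ TensorProduct.lift (slotMap k V n 0 ∘ₗ act)
  | 0 => rfl
  | n + 1 => by
    have h : LinearMap.rTensor (TPow k V n) (TensorProduct.lift act) ∘ₗ
        (TensorProduct.assoc k H V (TPow k V n)).symm.toLinearMap =
        TensorProduct.lift (LinearMap.rTensorHom (TPow k V n) ∘ₗ act) := by
      ext g c p
      rfl
    exact congrArg (fun f => rotOne (ModuleCat.of k V) (n + 1) ∘ₗ f) h

lemma frakTC_pow_succ (ρ : H →ₐ[k] Module.End k V) (n : ℕ) {j : ℕ} (hj : j ≤ n) :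
    frakTC ρ.toLinearMap n ^ (j + 1) =
      LinearMap.lTensor H (rotOne (ModuleCat.of k V) n ^ (j + 1)) ∘ₗ
        sandwOp (TensorProduct.lift (partialAct ρ n (j + 1)).toLinearMap) := by
  have h1 : frakTC ρ.toLinearMap n = LinearMap.lTensor H (rotOne (ModuleCat.of k V) n) ∘ₗ
      sandwOp (TensorProduct.lift (slotMap k V n 0 ∘ₗ ρ.toLinearMap)) := by
    rw [← sandwOp_comp_left, ← rotL_eq]
    rfl
  induction j with
  | zero =>
    rw [zero_add, pow_one, pow_one, h1, partialAct_succ ρ n n.zero_le,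
      partialAct_zero, revConv_counit]
  | succ j ih =>
    have h2 : TensorProduct.lift (slotMap k V n 0 ∘ₗ ρ.toLinearMap) ∘ₗ
        LinearMap.lTensor H (rotOne (ModuleCat.of k V) n ^ (j + 1)) =
        (rotOne (ModuleCat.of k V) n ^ (j + 1)) ∘ₗ
          TensorProduct.lift (slotMap k V n (j + 1) ∘ₗ ρ.toLinearMap) := by
      refine TensorProduct.ext' fun g p => ?_
      exact LinearMap.congr_fun (slotMap_zero_comp_rotOne_pow n hj (ρ g)) p
    rw [pow_succ', ih (by omega), Module.End.mul_eq_comp, h1, LinearMap.comp_assoc,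
      ← LinearMap.comp_assoc (sandwOp _) (LinearMap.lTensor H _), sandwOp_comp_lTensor, h2,
      sandwOp_comp_left, LinearMap.comp_assoc, sandwOp_lift_comp, ← partialAct_succ ρ n hj,
      ← LinearMap.comp_assoc, ← LinearMap.lTensor_comp, ← Module.End.mul_eq_comp (rotOne _ n),
      ← pow_succ']

lemma frakTC_pow_card (ρ : H →ₐ[k] Module.End k V) (n : ℕ) :
    frakTC ρ.toLinearMap n ^ (n + 1) =
      sandwOp (dact (ModuleCat.of k V) (TensorProduct.lift ρ.toLinearMap) n) := by
  rw [frakTC_pow_succ ρ n le_rfl, rotOne_pow_succ_self, lift_partialAct_eq_dact,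
    Module.End.one_eq_id, LinearMap.lTensor_id, LinearMap.id_comp]

/-- `h ⊗ (g ⊗ p) ↦ T (g h ⊗ p)`. -/
def mulThen {P : Type} [AddCommGroup P] [Module k P] (T : H ⊗[k] P →ₗ[k] H ⊗[k] P) :
    H ⊗[k] (H ⊗[k] P) →ₗ[k] H ⊗[k] P :=
  T ∘ₗ LinearMap.rTensor P (LinearMap.mul' k H ∘ₗ (TensorProduct.comm k H H).toLinearMap) ∘ₗ
    (TensorProduct.assoc k H H P).symm.toLinearMap

lemma mulThen_tmul {P : Type} [AddCommGroup P] [Module k P] (T : H ⊗[k] P →ₗ[k] H ⊗[k] P)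
    (h g : H) (p : P) : mulThen T (h ⊗ₜ (g ⊗ₜ p)) = T ((g * h) ⊗ₜ p) := by
  simp [mulThen]

lemma mulThen_one_tmul {P : Type} [AddCommGroup P] [Module k P]
    (T : H ⊗[k] P →ₗ[k] H ⊗[k] P) (x : H ⊗[k] P) : mulThen T ((1 : H) ⊗ₜ x) = T x := by
  induction x with
  | zero => simp
  | add x y hx hy => rw [tmul_add, map_add, map_add, hx, hy]
  | tmul g p => rw [mulThen_tmul, mul_one]

lemma mulThen_sandwOp_wAux {P : Type} [AddCommGroup P] [Module k P]
    (D : H →ₐ[k] Module.End k P) (s : H ⊗[k] (H ⊗[k] H)) (p : P) :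
    mulThen (sandwOp (TensorProduct.lift D.toLinearMap))
      (LinearMap.lTensor H (LinearMap.lTensor H (D.toLinearMap.flip p)) s) =
    LinearMap.lTensor H (D.toLinearMap.flip p) (sandwMul s) := by
  induction s with
  | zero => simp
  | add x y hx hy => simp only [map_add, hx, hy]
  | tmul h t =>
    induction t with
    | zero => simp
    | add x y hx hy => simp only [map_add, tmul_add, hx, hy]
    | tmul g w =>
      simp only [LinearMap.lTensor_tmul, mulThen_tmul, sandwOp_tmul, sandwMul_tmul]
      generalize (sandw (g * h) : H ⊗[k] H) = t
      induction t with
      | zero => simp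
      | add x y hx hy => simp only [map_add, add_mul, hx, hy]
      | tmul u v => simp

lemma sandwOp_dact_bigDelta {Sinv : H →ₗ[k] H}
    (hSinv₁ : ∀ h : H, Sinv (HopfAlgebra.antipode (R := k) h) = h)
    (hSinv₂ : ∀ h : H, HopfAlgebra.antipode (R := k) (Sinv h) = h)
    (ρ : H →ₐ[k] Module.End k V) (n : ℕ) (x : H ⊗[k] TPow k V n) :
    mulThen (sandwOp (dact (ModuleCat.of k V) (TensorProduct.lift ρ.toLinearMap) n))
      (bigDelta Sinv ρ.toLinearMap n x) = x := by
  let D := partialAct ρ n (n + 1)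
  induction x with
  | zero => simp
  | add x y hx hy => rw [map_add, map_add, hx, hy]
  | tmul g p =>
    have h (s : H ⊗[k] (H ⊗[k] H)) : LinearMap.lTensor H (LinearMap.lTensor H
        (TensorProduct.lift D.toLinearMap)) (LinearMap.lTensor H
          (TensorProduct.assoc k H H (TPow k V n)).toLinearMap
            (TensorProduct.assoc k H (H ⊗[k] H) (TPow k V n) (s ⊗ₜ p))) =
        LinearMap.lTensor H (LinearMap.lTensor H (D.toLinearMap.flip p)) s := by
      induction s with
      | zero => simp
      | add x y hx hy => simp only [map_add, add_tmul, hx, hy]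
      | tmul a t =>
        induction t with
        | zero => simp
        | add x y hx hy => simp only [map_add, tmul_add, add_tmul, hx, hy] at *
        | tmul b c => simp
    rw [bigDelta, ← lift_partialAct_eq_dact]
    refine (congrArg _ (h (wAux Sinv (delta4 g)))).trans ?_
    rw [mulThen_sandwOp_wAux, sandwMul_wAux_delta4 hSinv₁ hSinv₂]
    simp

end Iterate

/-- The operator `𝔱(g | a₀,…,aₙ) = (g⁽¹⁾ | a₁,…,aₙ, (g⁽⁰⁾S(g⁽²⁾)) · a₀)`
satisfies `𝔱^{n+1} = id` on the coinvariant space of the coaction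
`𝚫(g | a₀,…,aₙ) = (S(g⁽⁴⁾)g⁽¹⁾) ⊗ (g⁽³⁾ | (g⁽²⁾S⁻¹(g⁽⁰⁾)) · (a₀,…,aₙ))`. -/
theorem frakTC_iterate_coinvariant
    (Sinv : H →ₗ[k] H)
    (hSinv₁ : ∀ h : H, Sinv (HopfAlgebra.antipode (R := k) h) = h)
    (hSinv₂ : ∀ h : H, HopfAlgebra.antipode (R := k) (Sinv h) = h)
    (act : H →ₗ[k] C →ₗ[k] C)
    (hact_one : act 1 = LinearMap.id)
    (hact_mul : ∀ g h : H, act (g * h) = act g ∘ₗ act h)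
    (hact_comul : (Coalgebra.comul (R := k)) ∘ₗ TensorProduct.lift act
      = (TensorProduct.map (TensorProduct.lift act) (TensorProduct.lift act))
          ∘ₗ (TensorProduct.tensorTensorTensorComm k H H C C).toLinearMap
          ∘ₗ (TensorProduct.map (Coalgebra.comul (R := k)) (Coalgebra.comul (R := k))))
    (hact_counit : (Coalgebra.counit (R := k)) ∘ₗ TensorProduct.lift act
      = (TensorProduct.lid k k).toLinearMap
          ∘ₗ TensorProduct.map (Coalgebra.counit (R := k)) (Coalgebra.counit (R := k)))
    (n : ℕ) (x : H ⊗[k] ↥(Pw k (ModuleCat.of k C) n))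
    (hx : bigDelta Sinv act n x = (1 : H) ⊗ₜ[k] x) :
    ((frakTC act n) ^ (n+1)) x = x := by
  let ρ : H →ₐ[k] Module.End k C := AlgHom.ofLinearMap act hact_one hact_mul
  have h := sandwOp_dact_bigDelta hSinv₁ hSinv₂ ρ n x
  rw [show bigDelta Sinv ρ.toLinearMap n x = (1 : H) ⊗ₜ[k] x from hx, mulThen_one_tmul,
    ← frakTC_pow_card] at h
  exact h

end
end
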